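/- arXiv:1711.03348 — 2 statements merged into one kernel-verified Lean document; each statement's English description precedes it below -/
import Mathlib

section
/- Differential equation for variationally biharmonic maps (Lemma 1, for sphere-valued maps on the half-ball): Let m ≥ 2, n ≥ 2 be integers and R > 0. Let g ∈ C³(cl(B⁺_R), S^{n−1}) and let u ∈ C²(cl(B⁺_R), S^{n−1}) be variationally biharmonic with respect to the boundary data g. Then for every ξ ∈ C^∞(cl(B⁺_R), ℝ^m) satisfying ξ^m(x) = 0 for all x ∈ T_R and ξ(x)·x = 0 for all x with |x| = R, x^m ≥ 0, the following identity holds: ∫_{B⁺_R} ( 4 γ^{ij} (Δ_γu)·u_{ik} ∂_jξ^k + 2 (Δ_γu)·u_k Δ_γξ^k − |Δ_γu|² div_γξ ) dμ_γ = ∫_{B⁺_R} ( 2 (Δ_γu)·Δ_γ[ Dgξ − ((Dgξ)·u) u ] + 2 ∂_lγ^{ij} ξ^l (Δ_γu)·u_{ij} − 2 ∂_l(γ^{ij}Γ^k_{ij}) ξ^l (Δ_γu)·u_k ) dμ_γ, where Dgξ := ξ^l ∂_lg, div_γξ := (1/√γ) ∂_k(√γ ξ^k), and Δ_γ acts componentwise.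 (Note that the derivative of π at u ∈ S^{n−1} is v ↦ v − (v·u)u.) -/
open MeasureTheory RealInnerProductSpace

noncomputable section

abbrev Em (m : ℕ) := EuclideanSpace ℝ (Fin m)

def lastCoord {m : ℕ} (x : Em m) : ℝ := if h : 0 < m then x ⟨m - 1, by omega⟩ else 0

/-- The upper half-ball `B⁺_R = {x : |x| < R, xᵐ ≥ 0}`. -/
def halfBall (m : ℕ) (R : ℝ) : Set (Em m) := {x | ‖x‖ < R ∧ 0 ≤ lastCoord x}

/-- The flat boundary part `T_R = {x : |x| ≤ R, xᵐ = 0}`. -/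
def tPart (m : ℕ) (r : ℝ) : Set (Em m) := {x | ‖x‖ ≤ r ∧ lastCoord x = 0}

/-- Partial derivative in the `i`-th coordinate direction. -/
def pd {m : ℕ} {F : Type*} [NormedAddCommGroup F] [NormedSpace ℝ F]
    (i : Fin m) (u : Em m → F) : Em m → F :=
  fun x => fderiv ℝ u x (EuclideanSpace.single i 1)

/-- The Riemannian density `√γ = √(det(γ_{ij}))`. -/
def sqg {m : ℕ} (γ : Em m → Matrix (Fin m) (Fin m) ℝ) (x : Em m) : ℝ := Real.sqrt (γ x).det

/-- The Riemannian measure `μ_γ = √γ · Lebesgue`. -/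
def muG {m : ℕ} (γ : Em m → Matrix (Fin m) (Fin m) ℝ) : Measure (Em m) :=
  volume.withDensity fun x => ENNReal.ofReal (sqg γ x)

/-- The inverse metric `(γ^{ij})`. -/
def ginv {m : ℕ} (γ : Em m → Matrix (Fin m) (Fin m) ℝ) (x : Em m) :
    Matrix (Fin m) (Fin m) ℝ := (γ x)⁻¹

/-- Christoffel symbols `Γ^k_{ij}` of the second kind. -/
def christoffel {m : ℕ} (γ : Em m → Matrix (Fin m) (Fin m) ℝ) (k i j : Fin m) (x : Em m) : ℝ :=
  (1/2) * ∑ l, ginv γ x k l *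
    (pd i (fun y => γ y j l) x - pd l (fun y => γ y i j) x + pd j (fun y => γ y i l) x)

/-- The Laplace–Beltrami operator `Δ_γu = γ^{ij}(∂_i∂_ju − Γ^k_{ij}∂_ku)`, componentwise. -/
def lapB {m n : ℕ} (γ : Em m → Matrix (Fin m) (Fin m) ℝ) (u : Em m → Em n) (x : Em m) : Em n :=
  ∑ i, ∑ j, ginv γ x i j • (pd i (pd j u) x - ∑ k, christoffel γ k i j x • pd k u x)

/-- Nearest-point projection of `ℝⁿ∖{0}` onto the unit sphere. -/
def sphProj {n : ℕ} (p : Em n) : Em n := ‖p‖⁻¹ • p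

/-- `u` is variationally biharmonic with respect to the Dirichlet boundary data `g`:
the bienergy `E(v) = ∫_{B⁺_R}|Δ_γv|²dμ_γ` is critical (i) for outer variations
`π∘(u + tψ)`, `ψ ∈ C_c^∞(B⁺_R,ℝⁿ)`, and (ii) for variations
`π∘(u∘φ_t − g∘φ_t + g)` along families of diffeomorphisms `φ_t` of `cl B⁺_R` with
`φ₀ = id` preserving the boundary. -/
def VarBiharmonic (m n : ℕ) (R : ℝ) (γ : Em m → Matrix (Fin m) (Fin m) ℝ)
    (g u : Em m → Em n) : Prop :=
  (∀ ψ : Em m → Em n, ContDiff ℝ (⊤ : ℕ∞) ψ → HasCompactSupport ψ →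
      tsupport ψ ⊆ halfBall m R →
    HasDerivAt (fun t : ℝ =>
      ∫ x in halfBall m R, ‖lapB γ (fun y => sphProj (u y + t • ψ y)) x‖ ^ 2 ∂muG γ) 0 0) ∧
  (∀ φ : ℝ → Em m → Em m,
    ContDiff ℝ (⊤ : ℕ∞) (fun p : ℝ × Em m => φ p.1 p.2) →
    (∀ x, φ 0 x = x) →
    (∀ t ∈ Set.Ioo (-1:ℝ) 1, Set.BijOn (φ t) (closure (halfBall m R)) (closure (halfBall m R))) →
    (∀ t ∈ Set.Ioo (-1:ℝ) 1,
      Set.MapsTo (φ t) (frontier (halfBall m R)) (frontier (halfBall m R))) →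
    HasDerivAt (fun t : ℝ =>
      ∫ x in halfBall m R,
        ‖lapB γ (fun y => sphProj (u (φ t y) - g (φ t y) + g y)) x‖ ^ 2 ∂muG γ) 0 0)

section Families

variable {E F G H : Type} [NormedAddCommGroup E] [NormedSpace ℝ E]
  [NormedAddCommGroup F] [NormedSpace ℝ F] [NormedAddCommGroup G] [NormedSpace ℝ G]
  [NormedAddCommGroup H] [NormedSpace ℝ H]

/-- `p'` is the `t`-derivative of the family `p` on `I × U`; both are bounded, and continuous on
each slice. -/
structure BddDiffFamily (I : Set ℝ) (U : Set E) (p p' : ℝ → E → F) : Prop where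
  bdd : ∃ C, ∀ t ∈ I, ∀ y ∈ U, ‖p t y‖ ≤ C
  bdd' : ∃ C, ∀ t ∈ I, ∀ y ∈ U, ‖p' t y‖ ≤ C
  deriv : ∀ t ∈ I, ∀ y ∈ U, HasDerivAt (fun s => p s y) (p' t y) t
  cont : ∀ t ∈ I, ContinuousOn (p t) U
  cont' : ∀ t ∈ I, ContinuousOn (p' t) U

/-- `p` and `p'` are `k` times differentiable in space, and the first `k` spatial derivatives
of `p'` are the `t`-derivatives of those of `p`, with uniform bounds. -/
def DiffFamily (I : Set ℝ) (U : Set E) :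
    ℕ → ∀ {F : Type} [NormedAddCommGroup F] [NormedSpace ℝ F], (ℝ → E → F) → (ℝ → E → F) → Prop
  | 0, _, _, _, p, p' => BddDiffFamily I U p p'
  | k + 1, _, _, _, p, p' => BddDiffFamily I U p p' ∧
      (∀ t ∈ I, ∀ y ∈ U, DifferentiableAt ℝ (p t) y ∧ DifferentiableAt ℝ (p' t) y) ∧
      DiffFamily I U k (fun t => fderiv ℝ (p t)) (fun t => fderiv ℝ (p' t))

/-- `f` is `k` times differentiable on the open set `V`, with bounded continuous derivatives. -/
def BddDiff (V : Set E) :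
    ℕ → ∀ {F : Type} [NormedAddCommGroup F] [NormedSpace ℝ F], (E → F) → Prop
  | 0, _, _, _, f => (∃ C, ∀ y ∈ V, ‖f y‖ ≤ C) ∧ ContinuousOn f V
  | k + 1, _, _, _, f => ((∃ C, ∀ y ∈ V, ‖f y‖ ≤ C) ∧ ContinuousOn f V) ∧
      (∀ y ∈ V, DifferentiableAt ℝ f y) ∧ BddDiff V k (fderiv ℝ f)

variable {I : Set ℝ} {U : Set E}

theorem DiffFamily.base {k : ℕ} {p p' : ℝ → E → F} (h : DiffFamily I U k p p') :
    BddDiffFamily I U p p' := by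
  cases k with
  | zero => exact h
  | succ k => exact h.1

theorem DiffFamily.pred {k : ℕ} {p p' : ℝ → E → F} (h : DiffFamily I U (k + 1) p p') :
    DiffFamily I U k p p' := by
  induction k generalizing F with
  | zero => exact h.1
  | succ k ih => exact ⟨h.1, h.2.1, ih h.2.2⟩

theorem BddDiff.base {V : Set E} {k : ℕ} {f : E → F} (h : BddDiff V k f) :
    (∃ C, ∀ y ∈ V, ‖f y‖ ≤ C) ∧ ContinuousOn f V := by
  cases k with
  | zero => exact h
  | succ k => exact h.1

theorem fderiv_eq_of_eqOn {f g : E → F} (hU : IsOpen U) (h : ∀ y ∈ U, f y = g y) {y : E}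
    (hy : y ∈ U) : fderiv ℝ f y = fderiv ℝ g y :=
  Filter.EventuallyEq.fderiv_eq (Filter.eventuallyEq_of_mem (hU.mem_nhds hy) h)

theorem BddDiffFamily.congr {p p' q q' : ℝ → E → F} (hI : IsOpen I)
    (h : BddDiffFamily I U p p') (hq : ∀ t ∈ I, ∀ y ∈ U, p t y = q t y)
    (hq' : ∀ t ∈ I, ∀ y ∈ U, p' t y = q' t y) : BddDiffFamily I U q q' where
  bdd := h.bdd.imp fun C hC t ht y hy => hq t ht y hy ▸ hC t ht y hy
  bdd' := h.bdd'.imp fun C hC t ht y hy => hq' t ht y hy ▸ hC t ht y hy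
  deriv t ht y hy := by
    rw [← hq' t ht y hy]
    refine (h.deriv t ht y hy).congr_of_eventuallyEq ?_
    filter_upwards [hI.mem_nhds ht] with s hs using (hq s hs y hy).symm
  cont t ht := (h.cont t ht).congr fun y hy => (hq t ht y hy).symm
  cont' t ht := (h.cont' t ht).congr fun y hy => (hq' t ht y hy).symm

theorem DiffFamily.congr {k : ℕ} {p p' q q' : ℝ → E → F} (hI : IsOpen I) (hU : IsOpen U)
    (h : DiffFamily I U k p p') (hq : ∀ t ∈ I, ∀ y ∈ U, p t y = q t y)
    (hq' : ∀ t ∈ I, ∀ y ∈ U, p' t y = q' t y) : DiffFamily I U k q q' := by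
  induction k generalizing F with
  | zero => exact BddDiffFamily.congr hI h hq hq'
  | succ k ih =>
    refine ⟨h.1.congr hI hq hq', fun t ht y hy => ?_, ih h.2.2
      (fun t ht y hy => fderiv_eq_of_eqOn hU (hq t ht) hy)
      (fun t ht y hy => fderiv_eq_of_eqOn hU (hq' t ht) hy)⟩
    obtain ⟨h1, h2⟩ := h.2.1 t ht y hy
    exact ⟨h1.congr_of_eventuallyEq
        (Filter.eventuallyEq_of_mem (hU.mem_nhds hy) fun z hz => (hq t ht z hz).symm),
      h2.congr_of_eventuallyEq
        (Filter.eventuallyEq_of_mem (hU.mem_nhds hy) fun z hz => (hq' t ht z hz).symm)⟩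

theorem BddDiff.congr {k : ℕ} {f g : E → F} (hU : IsOpen U) (h : BddDiff U k f)
    (hfg : ∀ y ∈ U, f y = g y) : BddDiff U k g := by
  have base : ∀ {F : Type} [NormedAddCommGroup F] [NormedSpace ℝ F] {f g : E → F},
      ((∃ C, ∀ y ∈ U, ‖f y‖ ≤ C) ∧ ContinuousOn f U) → (∀ y ∈ U, f y = g y) →
      ((∃ C, ∀ y ∈ U, ‖g y‖ ≤ C) ∧ ContinuousOn g U) := fun h hfg =>
    ⟨h.1.imp fun C hC y hy => hfg y hy ▸ hC y hy, h.2.congr fun y hy => (hfg y hy).symm⟩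
  induction k generalizing F with
  | zero => exact base h hfg
  | succ k ih =>
    exact ⟨base h.1 hfg, fun y hy => (h.2.1 y hy).congr_of_eventuallyEq
      (Filter.eventuallyEq_of_mem (hU.mem_nhds hy) fun z hz => (hfg z hz).symm),
      ih h.2.2 fun y hy => fderiv_eq_of_eqOn hU hfg hy⟩

theorem DiffFamily.add {k : ℕ} {p p' q q' : ℝ → E → F} (hI : IsOpen I) (hU : IsOpen U)
    (hp : DiffFamily I U k p p') (hq : DiffFamily I U k q q') :
    DiffFamily I U k (fun t y => p t y + q t y) (fun t y => p' t y + q' t y) := by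
  have base : ∀ {F : Type} [NormedAddCommGroup F] [NormedSpace ℝ F] {p p' q q' : ℝ → E → F},
      BddDiffFamily I U p p' → BddDiffFamily I U q q' →
      BddDiffFamily I U (fun t y => p t y + q t y) (fun t y => p' t y + q' t y) := by
    intro F _ _ p p' q q' hp hq
    obtain ⟨⟨C, hC⟩, ⟨C', hC'⟩, h1, h2, h3⟩ := hp
    obtain ⟨⟨D, hD⟩, ⟨D', hD'⟩, h4, h5, h6⟩ := hq
    exact ⟨⟨C + D, fun t ht y hy => norm_add_le_of_le (hC t ht y hy) (hD t ht y hy)⟩,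
      ⟨C' + D', fun t ht y hy => norm_add_le_of_le (hC' t ht y hy) (hD' t ht y hy)⟩,
      fun t ht y hy => (h1 t ht y hy).add (h4 t ht y hy),
      fun t ht => (h2 t ht).add (h5 t ht), fun t ht => (h3 t ht).add (h6 t ht)⟩
  induction k generalizing F with
  | zero => exact base hp hq
  | succ k ih =>
    refine ⟨base hp.1 hq.1, fun t ht y hy => ⟨(hp.2.1 t ht y hy).1.add (hq.2.1 t ht y hy).1,
      (hp.2.1 t ht y hy).2.add (hq.2.1 t ht y hy).2⟩, (ih hp.2.2 hq.2.2).congr hI hU ?_ ?_⟩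
    · exact fun t ht y hy => (fderiv_add (hp.2.1 t ht y hy).1 (hq.2.1 t ht y hy).1).symm
    · exact fun t ht y hy => (fderiv_add (hp.2.1 t ht y hy).2 (hq.2.1 t ht y hy).2).symm

theorem BddDiffFamily.bilin {p p' : ℝ → E → F} {q q' : ℝ → E → G} (L : F →L[ℝ] G →L[ℝ] H)
    (hp : BddDiffFamily I U p p') (hq : BddDiffFamily I U q q') :
    BddDiffFamily I U (fun t y => L (p t y) (q t y))
      (fun t y => L (p t y) (q' t y) + L (p' t y) (q t y)) := by
  obtain ⟨⟨C, hC⟩, ⟨C', hC'⟩, h1, h2, h3⟩ := hp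
  obtain ⟨⟨D, hD⟩, ⟨D', hD'⟩, h4, h5, h6⟩ := hq
  have key : ∀ {a : F} {b : G} {A B : ℝ}, ‖a‖ ≤ A → ‖b‖ ≤ B → ‖L a b‖ ≤ ‖L‖ * A * B := by
    intro a b A B ha hb
    have hA := (norm_nonneg a).trans ha
    exact (L.le_opNorm₂ a b).trans (by gcongr)
  exact ⟨⟨_, fun t ht y hy => key (hC t ht y hy) (hD t ht y hy)⟩,
    ⟨_, fun t ht y hy => norm_add_le_of_le (key (hC t ht y hy) (hD' t ht y hy))
      (key (hC' t ht y hy) (hD t ht y hy))⟩,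
    fun t ht y hy => L.hasDerivAt_of_bilinear (fun _ => h1 t ht y hy) (fun _ => h4 t ht y hy),
    fun t ht => (L.continuous.comp_continuousOn (h2 t ht)).clm_apply (h5 t ht),
    fun t ht => ((L.continuous.comp_continuousOn (h2 t ht)).clm_apply (h6 t ht)).add
      ((L.continuous.comp_continuousOn (h3 t ht)).clm_apply (h5 t ht))⟩

theorem DiffFamily.bilin {k : ℕ} {p p' : ℝ → E → F} {q q' : ℝ → E → G} (hI : IsOpen I)
    (hU : IsOpen U) (L : F →L[ℝ] G →L[ℝ] H)
    (hp : DiffFamily I U k p p') (hq : DiffFamily I U k q q') :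
    DiffFamily I U k (fun t y => L (p t y) (q t y))
      (fun t y => L (p t y) (q' t y) + L (p' t y) (q t y)) := by
  induction k generalizing F G H with
  | zero => exact BddDiffFamily.bilin L hp hq
  | succ k ih =>
    have hd : ∀ t ∈ I, ∀ y ∈ U, _ := fun t ht y hy =>
      L.hasFDerivAt_of_bilinear (hp.2.1 t ht y hy).1.hasFDerivAt (hq.2.1 t ht y hy).1.hasFDerivAt
    have hd' : ∀ t ∈ I, ∀ y ∈ U, _ := fun t ht y hy =>
      (L.hasFDerivAt_of_bilinear (hp.2.1 t ht y hy).1.hasFDerivAt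
        (hq.2.1 t ht y hy).2.hasFDerivAt).add (L.hasFDerivAt_of_bilinear
          (hp.2.1 t ht y hy).2.hasFDerivAt (hq.2.1 t ht y hy).1.hasFDerivAt)
    refine ⟨hp.1.bilin L hq.1, fun t ht y hy =>
      ⟨(hd t ht y hy).differentiableAt, (hd' t ht y hy).differentiableAt⟩, ?_⟩
    refine (DiffFamily.add hI hU (ih (L.precompR E) hp.pred hq.2.2)
      (ih (L.precompL E) hp.2.2 hq.pred)).congr hI hU
      (fun t ht y hy => (hd t ht y hy).fderiv.symm) (fun t ht y hy => ?_)
    refine Eq.trans ?_ (hd' t ht y hy).fderiv.symm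
    abel

theorem BddDiff.diffFamily {k : ℕ} {f : E → F} (hI : IsOpen I) (hU : IsOpen U)
    (h : BddDiff U k f) : DiffFamily I U k (fun _ => f) (fun _ _ => 0) := by
  have base : ∀ {F : Type} [NormedAddCommGroup F] [NormedSpace ℝ F] {f : E → F},
      ((∃ C, ∀ y ∈ U, ‖f y‖ ≤ C) ∧ ContinuousOn f U) →
      BddDiffFamily I U (fun _ => f) (fun _ _ => 0) := fun h =>
    ⟨h.1.imp fun C hC _ _ y hy => hC y hy, ⟨0, fun _ _ _ _ => by simp⟩,
      fun t _ y _ => hasDerivAt_const t _, fun _ _ => h.2, fun _ _ => continuousOn_const⟩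
  induction k generalizing F with
  | zero => exact base h
  | succ k ih =>
    exact ⟨base h.1, fun t _ y hy => ⟨h.2.1 y hy, differentiableAt_const _⟩,
      (ih h.2.2).congr hI hU (fun _ _ _ _ => rfl) fun t _ y _ => by simp⟩

theorem BddDiff.const (c : F) (k : ℕ) : BddDiff U k (fun _ => c) := by
  have base : ∀ {F : Type} [NormedAddCommGroup F] [NormedSpace ℝ F] (c : F),
      (∃ C, ∀ y ∈ U, ‖(fun _ => c : E → F) y‖ ≤ C) ∧ ContinuousOn (fun _ => c : E → F) U :=
    fun c => ⟨⟨‖c‖, fun _ _ => le_rfl⟩, continuousOn_const⟩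
  induction k generalizing F with
  | zero => exact base c
  | succ k ih =>
    refine ⟨base c, fun y _ => differentiableAt_const _, ?_⟩
    have : fderiv ℝ (fun _ : E => c) = fun _ => 0 := by ext1 y; simp
    rw [this]
    exact ih 0

theorem DiffFamily.clm {k : ℕ} {p p' : ℝ → E → F} (hI : IsOpen I) (hU : IsOpen U)
    (hp : DiffFamily I U k p p') (L : F →L[ℝ] G) :
    DiffFamily I U k (fun t y => L (p t y)) (fun t y => L (p' t y)) :=
  (((BddDiff.const L k).diffFamily hI hU).bilin hI hU (ContinuousLinearMap.id ℝ _) hp).congr hI hU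
    (fun _ _ _ _ => rfl) (fun _ _ _ _ => by simp)

theorem DiffFamily.sum {ι : Type} {k : ℕ} (s : Finset ι) {p p' : ι → ℝ → E → F} (hI : IsOpen I)
    (hU : IsOpen U) (hp : ∀ i ∈ s, DiffFamily I U k (p i) (p' i)) :
    DiffFamily I U k (fun t y => ∑ i ∈ s, p i t y) (fun t y => ∑ i ∈ s, p' i t y) := by
  classical
  induction s using Finset.induction_on with
  | empty => exact (((BddDiff.const (0 : F) k).diffFamily hI hU)).congr hI hU (by simp) (by simp)
  | insert i s hi ih =>
    simp only [Finset.sum_insert hi]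
    exact (hp i (Finset.mem_insert_self i s)).add hI hU
      (ih fun j hj => hp j (Finset.mem_insert_of_mem hj))

theorem BddDiffFamily.comp {p p' : ℝ → E → F} {V : Set F} {f : F → G}
    (hf : BddDiff V 1 f) (hp : BddDiffFamily I U p p')
    (hmaps : ∀ t ∈ I, ∀ y ∈ U, p t y ∈ V) :
    BddDiffFamily I U (fun t y => f (p t y)) (fun t y => fderiv ℝ f (p t y) (p' t y)) := by
  obtain ⟨⟨⟨C, hC⟩, hfc⟩, hfd, ⟨D, hD⟩, hfc'⟩ := hf
  obtain ⟨_, ⟨C', hC'⟩, h1, h2, h3⟩ := hp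
  refine ⟨⟨C, fun t ht y hy => hC _ (hmaps t ht y hy)⟩, ⟨D * C', fun t ht y hy => ?_⟩,
    fun t ht y hy => (hfd _ (hmaps t ht y hy)).hasFDerivAt.comp_hasDerivAt t (h1 t ht y hy),
    fun t ht => hfc.comp (h2 t ht) (hmaps t ht),
    fun t ht => (hfc'.comp (h2 t ht) (hmaps t ht)).clm_apply (h3 t ht)⟩
  have hD0 := (norm_nonneg _).trans (hD _ (hmaps t ht y hy))
  exact (ContinuousLinearMap.le_opNorm _ _).trans
    (mul_le_mul (hD _ (hmaps t ht y hy)) (hC' t ht y hy) (norm_nonneg _) hD0)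

theorem BddDiff.isSymm {V : Set F} {k : ℕ} {f : F → G} (hV : IsOpen V) (hf : BddDiff V (k + 2) f)
    {x : F} (hx : x ∈ V) (v w : F) :
    fderiv ℝ (fderiv ℝ f) x v w = fderiv ℝ (fderiv ℝ f) x w v :=
  second_derivative_symmetric_of_eventually
    (Filter.mem_of_superset (hV.mem_nhds hx) fun y hy => (hf.2.1 y hy).hasFDerivAt)
    (hf.2.2.2.1 x hx).hasFDerivAt v w

theorem DiffFamily.comp {k : ℕ} {p p' : ℝ → E → F} {V : Set F} {f : F → G} (hI : IsOpen I)
    (hU : IsOpen U) (hV : IsOpen V) (hf : BddDiff V (k + 1) f) (hp : DiffFamily I U k p p')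
    (hmaps : ∀ t ∈ I, ∀ y ∈ U, p t y ∈ V) :
    DiffFamily I U k (fun t y => f (p t y)) (fun t y => fderiv ℝ f (p t y) (p' t y)) := by
  induction k generalizing G with
  | zero => exact BddDiffFamily.comp hf hp hmaps
  | succ k ih =>
    have hd : ∀ t ∈ I, ∀ y ∈ U, HasFDerivAt (fun z => f (p t z))
        ((fderiv ℝ f (p t y)).comp (fderiv ℝ (p t) y)) y := fun t ht y hy =>
      (hf.2.1 _ (hmaps t ht y hy)).hasFDerivAt.comp y (hp.2.1 t ht y hy).1.hasFDerivAt
    have hd' : ∀ t ∈ I, ∀ y ∈ U, HasFDerivAt (fun z => fderiv ℝ f (p t z) (p' t z))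
        ((fderiv ℝ f (p t y)).comp (fderiv ℝ (p' t) y) +
        ((fderiv ℝ (fderiv ℝ f) (p t y)).comp (fderiv ℝ (p t) y)).flip (p' t y)) y :=
      fun t ht y hy => HasFDerivAt.clm_apply
        ((hf.2.2.2.1 _ (hmaps t ht y hy)).hasFDerivAt.comp y (hp.2.1 t ht y hy).1.hasFDerivAt)
        (hp.2.1 t ht y hy).2.hasFDerivAt
    refine ⟨BddDiffFamily.comp ?_ hp.1 hmaps, fun t ht y hy =>
      ⟨(hd t ht y hy).differentiableAt, (hd' t ht y hy).differentiableAt⟩, ?_⟩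
    · exact ⟨hf.1, hf.2.1, hf.2.2.base⟩
    · refine (DiffFamily.bilin hI hU (ContinuousLinearMap.compL ℝ E F G)
        (ih hf.2.2 hp.pred) hp.2.2).congr hI hU
        (fun t ht y hy => (hd t ht y hy).fderiv.symm) (fun t ht y hy => ?_)
      rw [(hd' t ht y hy).fderiv]
      ext v
      simp [hf.isSymm hV (hmaps t ht y hy) (p' t y)]

end Families

section Families

variable {E F G : Type} [NormedAddCommGroup E] [NormedSpace ℝ E]
  [NormedAddCommGroup F] [NormedSpace ℝ F] [NormedAddCommGroup G] [NormedSpace ℝ G]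

theorem ContDiffOn.bddDiff {K : Set E} (hK : IsCompact K) (hKu : UniqueDiffOn ℝ K) {k : ℕ}
    {f : E → F} (hf : ContDiffOn ℝ k f K) : BddDiff (interior K) k f := by
  have base : ∀ {F : Type} [NormedAddCommGroup F] [NormedSpace ℝ F] {f : E → F},
      ContinuousOn f K → (∃ C, ∀ y ∈ interior K, ‖f y‖ ≤ C) ∧ ContinuousOn f (interior K) := by
    intro F _ _ f hf
    obtain ⟨C, hC⟩ := hK.exists_bound_of_continuousOn hf
    exact ⟨⟨C, fun y hy => hC y (interior_subset hy)⟩, hf.mono interior_subset⟩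
  induction k generalizing F with
  | zero => exact base hf.continuousOn
  | succ k ih =>
    refine ⟨base hf.continuousOn, fun y hy => ?_, ?_⟩
    · exact (hf.differentiableOn (by simp)).differentiableAt (mem_interior_iff_mem_nhds.1 hy)
    · refine (ih (f := fderivWithin ℝ f K)
        (hf.fderivWithin hKu (by norm_cast))).congr isOpen_interior fun y hy => ?_
      exact fderivWithin_of_mem_nhds (mem_interior_iff_mem_nhds.1 hy)

theorem diffFamily_of_contDiffOn {K : Set E} (hK : IsCompact K) (hKu : UniqueDiffOn ℝ K)
    {a b : ℝ} (hab : a < b) {k : ℕ} {f : ℝ → E → F}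
    (hf : ContDiffOn ℝ (k + 1) (fun z : ℝ × E => f z.1 z.2) (Set.Icc a b ×ˢ K)) :
    DiffFamily (Set.Ioo a b) (interior K) k f
      (fun t y => fderiv ℝ (fun z : ℝ × E => f z.1 z.2) (t, y) (1, 0)) := by
  set Q : Set (ℝ × E) := Set.Icc a b ×ˢ K with hQ
  have hQc : IsCompact Q := isCompact_Icc.prod hK
  have hQu : UniqueDiffOn ℝ Q := (uniqueDiffOn_Icc hab).prod hKu
  have hQn : ∀ t ∈ Set.Ioo a b, ∀ y ∈ interior K, Q ∈ nhds (t, y) := fun t ht y hy =>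
    prod_mem_nhds (Icc_mem_nhds ht.1 ht.2) (mem_interior_iff_mem_nhds.1 hy)
  have hin : ∀ t ∈ Set.Ioo a b, Set.MapsTo (fun y : E => (t, y)) (interior K) Q :=
    fun t ht y hy => ⟨Set.Ioo_subset_Icc_self ht, interior_subset hy⟩
  have base : ∀ {F : Type} [NormedAddCommGroup F] [NormedSpace ℝ F] {f : ℝ → E → F},
      ContDiffOn ℝ 1 (fun z : ℝ × E => f z.1 z.2) Q →
      BddDiffFamily (Set.Ioo a b) (interior K) f
        (fun t y => fderiv ℝ (fun z : ℝ × E => f z.1 z.2) (t, y) (1, 0)) := by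
    intro F _ _ f hf
    have hc : ContinuousOn (fun z => fderivWithin ℝ (fun z : ℝ × E => f z.1 z.2) Q z (1, 0)) Q :=
      (hf.continuousOn_fderivWithin hQu le_rfl).clm_apply continuousOn_const
    have heq : ∀ t ∈ Set.Ioo a b, ∀ y ∈ interior K,
        fderivWithin ℝ (fun z : ℝ × E => f z.1 z.2) Q (t, y)
          = fderiv ℝ (fun z : ℝ × E => f z.1 z.2) (t, y) := fun t ht y hy =>
      fderivWithin_of_mem_nhds (hQn t ht y hy)
    obtain ⟨C, hC⟩ := hQc.exists_bound_of_continuousOn hf.continuousOn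
    obtain ⟨C', hC'⟩ := hQc.exists_bound_of_continuousOn hc
    refine ⟨⟨C, fun t ht y hy => hC _ (hin t ht hy)⟩, ⟨C', fun t ht y hy => ?_⟩,
      fun t ht y hy => ?_, fun t ht => ?_, fun t ht => ?_⟩
    · rw [← heq t ht y hy]; exact hC' _ (hin t ht hy)
    · have h1 : HasFDerivAt (fun z : ℝ × E => f z.1 z.2) _ (t, y) :=
        ((hf.differentiableOn one_ne_zero).differentiableAt (hQn t ht y hy)).hasFDerivAt
      have h2 : HasDerivAt (fun s : ℝ => (s, y)) ((1 : ℝ), (0 : E)) t :=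
        (hasDerivAt_id t).prodMk (hasDerivAt_const t y)
      exact h1.comp_hasDerivAt t h2
    · exact hf.continuousOn.comp (by fun_prop : ContinuousOn (fun y : E => (t, y)) _) (hin t ht)
    · refine (hc.comp (by fun_prop : ContinuousOn (fun y : E => (t, y)) _) (hin t ht)).congr
        fun y hy => ?_
      simp [heq t ht y hy]
  induction k generalizing F with
  | zero => exact base (by simpa using hf)
  | succ k ih =>
    set f₀ : ℝ × E → F := fun z => f z.1 z.2 with hf₀
    have hf1 : ContDiffOn ℝ (k + 1) (fderivWithin ℝ f₀ Q) Q :=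
      hf.fderivWithin hQu (by norm_cast)
    have hd : ∀ t ∈ Set.Ioo a b, ∀ y ∈ interior K, HasFDerivAt f₀ (fderiv ℝ f₀ (t, y)) (t, y) :=
      fun t ht y hy => ((hf.differentiableOn
        (by norm_cast)).differentiableAt (hQn t ht y hy)).hasFDerivAt
    have hev : ∀ t ∈ Set.Ioo a b, ∀ y ∈ interior K,
        fderivWithin ℝ f₀ Q =ᶠ[nhds (t, y)] fderiv ℝ f₀ := by
      intro t ht y hy
      filter_upwards [(isOpen_Ioo.prod isOpen_interior).mem_nhds (Set.mk_mem_prod ht hy)] with z hz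
      exact fderivWithin_of_mem_nhds (hQn z.1 hz.1 z.2 hz.2)
    have hd2 : ∀ t ∈ Set.Ioo a b, ∀ y ∈ interior K,
        HasFDerivAt (fderiv ℝ f₀) (fderiv ℝ (fderiv ℝ f₀) (t, y)) (t, y) := by
      intro t ht y hy
      have : DifferentiableAt ℝ (fderivWithin ℝ f₀ Q) (t, y) :=
        (hf1.differentiableOn (by simp)).differentiableAt (hQn t ht y hy)
      exact (this.congr_of_eventuallyEq (hev t ht y hy).symm).hasFDerivAt
    have hsl : ∀ (t : ℝ) (y : E),
        HasFDerivAt (fun z : E => (t, z)) (ContinuousLinearMap.inr ℝ ℝ E) y :=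
      fun t y => hasFDerivAt_prodMk_right t y
    have hp : ∀ t ∈ Set.Ioo a b, ∀ y ∈ interior K, HasFDerivAt (f t)
        ((fderiv ℝ f₀ (t, y)).comp (ContinuousLinearMap.inr ℝ ℝ E)) y := fun t ht y hy =>
      (hd t ht y hy).comp y (hsl t y)
    have hp' : ∀ t ∈ Set.Ioo a b, ∀ y ∈ interior K,
        HasFDerivAt (fun y => fderiv ℝ f₀ (t, y) (1, 0))
        (((fderiv ℝ (fderiv ℝ f₀) (t, y)).comp
          (ContinuousLinearMap.inr ℝ ℝ E)).flip (1, 0)) y := by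
      intro t ht y hy
      have := ((hd2 t ht y hy).comp y (hsl t y)).clm_apply (hasFDerivAt_const ((1 : ℝ), (0 : E)) y)
      simpa using this
    refine ⟨base (hf.of_le (by norm_cast; omega)), fun t ht y hy =>
      ⟨(hp t ht y hy).differentiableAt, (hp' t ht y hy).differentiableAt⟩, ?_⟩
    have hL : ContDiffOn ℝ (k + 1) (fun z : ℝ × E =>
        (fderivWithin ℝ f₀ Q z).comp (ContinuousLinearMap.inr ℝ ℝ E)) Q :=
      hf1.clm_comp contDiffOn_const
    refine (ih (f := fun t y => (fderivWithin ℝ f₀ Q (t, y)).comp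
      (ContinuousLinearMap.inr ℝ ℝ E)) hL).congr isOpen_Ioo isOpen_interior
      (fun t ht y hy => ?_) (fun t ht y hy => ?_)
    · rw [(hp t ht y hy).fderiv, (hev t ht y hy).eq_of_nhds]
    · rw [(hp' t ht y hy).fderiv]
      have h3 : HasFDerivAt (fun z : ℝ × E =>
          (fderivWithin ℝ f₀ Q z).comp (ContinuousLinearMap.inr ℝ ℝ E))
          (((ContinuousLinearMap.compL ℝ E (ℝ × E) F).flip
            (ContinuousLinearMap.inr ℝ ℝ E)).comp (fderiv ℝ (fderiv ℝ f₀) (t, y))) (t, y) :=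
        (ContinuousLinearMap.hasFDerivAt
          ((ContinuousLinearMap.compL ℝ E (ℝ × E) F).flip
            (ContinuousLinearMap.inr ℝ ℝ E))).comp (t, y)
          ((hd2 t ht y hy).congr_of_eventuallyEq (hev t ht y hy))
      rw [h3.fderiv]
      have hsy : ∀ v w, fderiv ℝ (fderiv ℝ f₀) (t, y) v w = fderiv ℝ (fderiv ℝ f₀) (t, y) w v := by
        refine second_derivative_symmetric_of_eventually (f := f₀) ?_ (hd2 t ht y hy)
        filter_upwards [(isOpen_Ioo.prod isOpen_interior).mem_nhds (Set.mk_mem_prod ht hy)]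
          with z hz using hd z.1 hz.1 z.2 hz.2
      ext v
      simp [hsy (1, 0)]

/-- Differentiation under the integral sign for a bounded family. -/
theorem BddDiffFamily.hasDerivAt_integral [MeasurableSpace E] [BorelSpace E]
    [SecondCountableTopology E] {μ : Measure E} {U : Set E} (hU : IsOpen U) (hμ : μ U < ⊤)
    {I : Set ℝ} (hI : IsOpen I) {p p' : ℝ → E → ℝ} (h : BddDiffFamily I U p p')
    {t : ℝ} (ht : t ∈ I) :
    IntegrableOn (p' t) U μ ∧ HasDerivAt (fun s => ∫ y in U, p s y ∂μ) (∫ y in U, p' t y ∂μ) t := by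
  obtain ⟨⟨C, hC⟩, ⟨C', hC'⟩, h1, h2, h3⟩ := h
  have : IsFiniteMeasure (μ.restrict U) := ⟨by simpa using hμ⟩
  refine hasDerivAt_integral_of_dominated_loc_of_deriv_le (bound := fun _ => C')
    (hI.mem_nhds ht) ?_ ?_ ((h3 t ht).aestronglyMeasurable hU.measurableSet) ?_
    (integrable_const _) ?_
  · filter_upwards [hI.mem_nhds ht] with s hs using (h2 s hs).aestronglyMeasurable hU.measurableSet
  · refine Integrable.of_bound ((h2 t ht).aestronglyMeasurable hU.measurableSet) C ?_
    exact ae_restrict_of_forall_mem hU.measurableSet (hC t ht)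
  · exact ae_restrict_of_forall_mem hU.measurableSet fun y hy s hs => hC' s hs y hy
  · exact ae_restrict_of_forall_mem hU.measurableSet fun y hy s hs => h1 s hs y hy

end Families

open scoped ContDiff in
/-- A smooth family of `1/2`-Lipschitz perturbations of the identity has a smooth family of
inverses. -/
theorem exists_contDiff_inverse {E : Type} [NormedAddCommGroup E] [NormedSpace ℝ E]
    [FiniteDimensional ℝ E] (φ : ℝ → E → E) (hφ : ContDiff ℝ ∞ (fun z : ℝ × E => φ z.1 z.2))
    (hl : ∀ t, LipschitzWith (1 / 2) (fun x => φ t x - x)) :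
    ∃ ψ : ℝ → E → E, ContDiff ℝ ∞ (fun z : ℝ × E => ψ z.1 z.2) ∧
      (∀ t x, ψ t (φ t x) = x) ∧ ∀ t y, φ t (ψ t y) = y := by
  have : CompleteSpace E := FiniteDimensional.complete ℝ E
  have hinj : ∀ t, Function.Injective (φ t) := by
    intro t x y hxy
    have h := (hl t).dist_le_mul x y
    rw [dist_eq_norm, dist_eq_norm, hxy,
      show φ t y - x - (φ t y - y) = -(x - y) by abel, norm_neg] at h
    have h0 := norm_nonneg (x - y)
    push_cast at h
    exact sub_eq_zero.1 (norm_eq_zero.1 (by linarith))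
  have hsurj : ∀ t, Function.Surjective (φ t) := by
    intro t y
    have hc : ContractingWith (1 / 2) (fun x => y - (φ t x - x)) := by
      refine ⟨by rw [← NNReal.coe_lt_coe]; push_cast; norm_num,
        LipschitzWith.of_dist_le_mul fun a b => ?_⟩
      rw [dist_sub_left]
      exact (hl t).dist_le_mul a b
    refine ⟨ContractingWith.fixedPoint _ hc, ?_⟩
    have := hc.fixedPoint_isFixedPt
    have h2 : y - (φ t (ContractingWith.fixedPoint _ hc) - ContractingWith.fixedPoint _ hc)
      = ContractingWith.fixedPoint _ hc := this
    rw [sub_eq_iff_eq_add, add_sub_cancel] at h2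
    exact h2.symm
  set Φ : ℝ × E → ℝ × E := fun z => (z.1, φ z.1 z.2) with hΦ
  have hΦs : ContDiff ℝ ∞ Φ := contDiff_fst.prodMk hφ
  have hbij : Function.Bijective Φ := by
    constructor
    · rintro ⟨t, x⟩ ⟨s, y⟩ h
      obtain ⟨rfl, h2⟩ := Prod.mk.inj h
      exact Prod.ext rfl (hinj t h2)
    · rintro ⟨t, y⟩
      obtain ⟨x, hx⟩ := hsurj t y
      exact ⟨(t, x), by simp [hΦ, hx]⟩
  have hder : ∀ z, ∃ e : (ℝ × E) ≃L[ℝ] (ℝ × E), fderiv ℝ Φ z = e := by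
    rintro ⟨t, x⟩
    have hd : HasFDerivAt (fun z : ℝ × E => φ z.1 z.2)
        (fderiv ℝ (fun z : ℝ × E => φ z.1 z.2) (t, x)) (t, x) :=
      (hφ.differentiable (by simp) _).hasFDerivAt
    have h1 : HasFDerivAt Φ _ (t, x) := hasFDerivAt_fst.prodMk hd
    have hsl : HasFDerivAt (fun y => φ t y - y)
        ((fderiv ℝ (fun z : ℝ × E => φ z.1 z.2) (t, x)).comp (ContinuousLinearMap.inr ℝ ℝ E)
          - ContinuousLinearMap.id ℝ E) x :=
      (hd.comp x (hasFDerivAt_prodMk_right t x)).sub (hasFDerivAt_id x)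
    have hb := hsl.le_of_lipschitz (hl t)
    have hI : Function.Injective (fderiv ℝ Φ (t, x)) := by
      rw [injective_iff_map_eq_zero]
      rintro ⟨τ, v⟩ h
      rw [h1.fderiv] at h
      obtain ⟨h2, h3⟩ := Prod.mk.inj h
      simp only at h2
      subst h2
      have h4 := ContinuousLinearMap.le_of_opNorm_le _ hb v
      have h5 : (((fderiv ℝ (fun z : ℝ × E => φ z.1 z.2) (t, x)).comp
        (ContinuousLinearMap.inr ℝ ℝ E) - ContinuousLinearMap.id ℝ E)) v = -v := by
        simp only [sub_apply, ContinuousLinearMap.comp_apply,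
          ContinuousLinearMap.inr_apply, ContinuousLinearMap.id_apply]
        exact (congrArg (· - v) h3).trans (zero_sub v)
      rw [h5, norm_neg] at h4
      have h0 := norm_nonneg v
      push_cast at h4
      have : v = 0 := norm_eq_zero.1 (by linarith)
      simp [this]
    refine ⟨ContinuousLinearEquiv.ofBijective (fderiv ℝ Φ (t, x)) (LinearMap.ker_eq_bot.2 hI)
      (LinearMap.range_eq_top.2 ((LinearMap.injective_iff_surjective
        (f := (fderiv ℝ Φ (t, x) : (ℝ × E) →ₗ[ℝ] (ℝ × E)))).1 hI)), ?_⟩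
    ext <;> simp
  choose e he using hder
  have hopen : IsOpenMap Φ := by
    refine isOpenMap_of_hasStrictFDerivAt_equiv (f' := e) fun z => ?_
    rw [← he z]
    exact hΦs.contDiffAt.hasStrictFDerivAt (by simp)
  let h : (ℝ × E) ≃ₜ (ℝ × E) :=
    (Equiv.ofBijective Φ hbij).toHomeomorphOfContinuousOpen hΦs.continuous hopen
  have hs : ContDiff ℝ ∞ h.symm := h.contDiff_symm (f₀' := e) (fun z => by
    rw [← he z]
    exact (hΦs.differentiable (by simp) z).hasFDerivAt) hΦs
  have hr : ∀ z, Φ (h.symm z) = z := h.apply_symm_apply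
  have hright : ∀ t y, φ t (h.symm (t, y)).2 = y := by
    intro t y
    obtain ⟨h1, h2⟩ := Prod.mk.inj (hr (t, y))
    rw [h1] at h2
    exact h2
  refine ⟨fun t y => (h.symm (t, y)).2, contDiff_snd.comp hs, fun t x => ?_, hright⟩
  exact hinj t (hright t _)

section HalfBall

variable {m : ℕ}

/-- The last coordinate as a continuous linear functional. -/
def lastCLM (m : ℕ) : Em m →L[ℝ] ℝ :=
  if h : 0 < m then EuclideanSpace.proj (⟨m - 1, by omega⟩ : Fin m) else 0

/-- The last standard basis vector. -/
def lastVec (m : ℕ) : Em m :=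
  if h : 0 < m then EuclideanSpace.single (⟨m - 1, by omega⟩ : Fin m) 1 else 0

theorem lastCoord_eq (x : Em m) : lastCoord x = lastCLM m x := by
  unfold lastCoord lastCLM
  split_ifs <;> simp

theorem lastCLM_lastVec (hm : 0 < m) : lastCLM m (lastVec m) = 1 := by
  simp [lastCLM, lastVec, hm]

theorem norm_lastVec (hm : 0 < m) : ‖lastVec m‖ = 1 := by
  simp [lastVec, hm]

theorem inner_lastVec (x : Em m) : ⟪lastVec m, x⟫ = lastCLM m x := by
  unfold lastCLM lastVec
  split_ifs <;> simp [EuclideanSpace.inner_single_left]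

theorem isOpenMap_lastCLM (hm : 0 < m) : IsOpenMap (lastCLM m) :=
  (lastCLM m).isOpenMap fun r => ⟨r • lastVec m, by simp [lastCLM_lastVec hm]⟩

/-- The open upper half-ball. -/
def openHalfBall (m : ℕ) (R : ℝ) : Set (Em m) := {x | ‖x‖ < R ∧ 0 < lastCLM m x}

/-- The closed upper half-ball. -/
def closedHalfBall (m : ℕ) (R : ℝ) : Set (Em m) := {x | ‖x‖ ≤ R ∧ 0 ≤ lastCLM m x}

theorem isOpen_openHalfBall (R : ℝ) : IsOpen (openHalfBall m R) :=
  (isOpen_lt continuous_norm continuous_const).inter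
    (isOpen_lt continuous_const (lastCLM m).continuous)

theorem isClosed_closedHalfBall (R : ℝ) : IsClosed (closedHalfBall m R) :=
  (isClosed_le continuous_norm continuous_const).inter
    (isClosed_le continuous_const (lastCLM m).continuous)

theorem convex_closedHalfBall (R : ℝ) : Convex ℝ (closedHalfBall m R) := by
  have : closedHalfBall m R = Metric.closedBall 0 R ∩ lastCLM m ⁻¹' Set.Ici 0 := by
    ext; simp [closedHalfBall]
  rw [this]
  exact (convex_closedBall _ _).inter ((convex_Ici 0).linear_preimage (lastCLM m : Em m →ₗ[ℝ] ℝ))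

theorem isCompact_closedHalfBall (R : ℝ) : IsCompact (closedHalfBall m R) :=
  (isCompact_closedBall (0 : Em m) R).of_isClosed_subset (isClosed_closedHalfBall R)
    fun x hx => by simpa using hx.1

variable {R : ℝ}

theorem interior_halfBall (hm : 0 < m) : interior (halfBall m R) = openHalfBall m R := by
  have : halfBall m R = Metric.ball 0 R ∩ lastCLM m ⁻¹' Set.Ici 0 := by
    ext; simp [halfBall, lastCoord_eq]
  rw [this, interior_inter, Metric.isOpen_ball.interior_eq,
    ← (isOpenMap_lastCLM hm).preimage_interior_eq_interior_preimage (lastCLM m).continuous,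
    interior_Ici]
  ext; simp [openHalfBall]

theorem interior_closedHalfBall (hm : 0 < m) (hR : 0 < R) :
    interior (closedHalfBall m R) = openHalfBall m R := by
  have : closedHalfBall m R = Metric.closedBall 0 R ∩ lastCLM m ⁻¹' Set.Ici 0 := by
    ext; simp [closedHalfBall]
  rw [this, interior_inter, interior_closedBall _ hR.ne',
    ← (isOpenMap_lastCLM hm).preimage_interior_eq_interior_preimage (lastCLM m).continuous,
    interior_Ici]
  ext; simp [openHalfBall]

theorem halfLastVec_mem (hm : 0 < m) (hR : 0 < R) : (R / 2) • lastVec m ∈ openHalfBall m R := by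
  constructor
  · rw [norm_smul, norm_lastVec hm, Real.norm_of_nonneg (by positivity)]; linarith
  · simp [lastCLM_lastVec hm, hR]

theorem closure_halfBall (hm : 0 < m) (hR : 0 < R) :
    closure (halfBall m R) = closedHalfBall m R := by
  apply subset_antisymm
  · refine closure_minimal (fun x hx => ⟨hx.1.le, ?_⟩) (isClosed_closedHalfBall R)
    rw [← lastCoord_eq]; exact hx.2
  · have hne : (interior (closedHalfBall m R)).Nonempty :=
      ⟨_, (interior_closedHalfBall hm hR).symm ▸ halfLastVec_mem hm hR⟩
    calc closedHalfBall m R ⊆ closure (closedHalfBall m R) := subset_closure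
      _ = closure (interior (closedHalfBall m R)) :=
        ((convex_closedHalfBall R).closure_interior_eq_closure_of_nonempty_interior hne).symm
      _ ⊆ closure (halfBall m R) := by
        rw [interior_closedHalfBall hm hR, ← interior_halfBall hm]
        exact closure_mono interior_subset

theorem uniqueDiffOn_closedHalfBall (hm : 0 < m) (hR : 0 < R) :
    UniqueDiffOn ℝ (closedHalfBall m R) :=
  uniqueDiffOn_convex (convex_closedHalfBall R)
    ⟨_, (interior_closedHalfBall hm hR).symm ▸ halfLastVec_mem hm hR⟩

theorem openHalfBall_subset : openHalfBall m R ⊆ closedHalfBall m R :=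
  fun _ hx => ⟨hx.1.le, hx.2.le⟩

theorem halfBall_ae_eq (hm : 0 < m) :
    (halfBall m R : Set (Em m)) =ᵐ[volume] openHalfBall m R := by
  rw [← interior_halfBall hm]
  have hc : Convex ℝ (halfBall m R) := by
    have : halfBall m R = Metric.ball 0 R ∩ lastCLM m ⁻¹' Set.Ici 0 := by
      ext; simp [halfBall, lastCoord_eq]
    rw [this]
    exact (convex_ball _ _).inter ((convex_Ici 0).linear_preimage (lastCLM m : Em m →ₗ[ℝ] ℝ))
  exact (interior_ae_eq_of_null_frontier (hc.addHaar_frontier volume)).symm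

theorem pos_add_iff {a b : ℝ} (h : |b| ≤ |a| / 2) : 0 < a + b ↔ 0 < a := by
  rcases abs_cases a with ⟨h1, h2⟩ | ⟨h1, h2⟩ <;> rcases abs_cases b with ⟨h3, h4⟩ | ⟨h3, h4⟩ <;>
    constructor <;> intro _ <;> linarith

theorem nonneg_add_iff {a b : ℝ} (h : |b| ≤ |a| / 2) : 0 ≤ a + b ↔ 0 ≤ a := by
  rcases abs_cases a with ⟨h1, h2⟩ | ⟨h1, h2⟩ <;> rcases abs_cases b with ⟨h3, h4⟩ | ⟨h3, h4⟩ <;>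
    constructor <;> intro _ <;> linarith

open scoped ContDiff

theorem exists_fderiv_small {η : ℝ → Em m → Em m}
    (hηs : ContDiff ℝ ∞ (fun z : ℝ × Em m => η z.1 z.2)) (h0 : ∀ x, η 0 x = 0)
    {S : Set (Em m)} (hS : IsCompact S) (hout : ∀ s, ∀ x ∉ S, η s x = 0) :
    ∃ δ > 0, ∀ s, |s| < δ → ∀ x, ‖fderiv ℝ (η s) x‖ ≤ 1 / 2 := by
  have hηd : ∀ s x, fderiv ℝ (η s) x = (fderiv ℝ (fun z : ℝ × Em m => η z.1 z.2) (s, x)).comp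
      (ContinuousLinearMap.inr ℝ ℝ (Em m)) := fun s x =>
    (((hηs.differentiable (by simp) _).hasFDerivAt).comp x
      (hasFDerivAt_prodMk_right s x)).fderiv
  have hcont : Continuous fun z : ℝ × Em m => ‖fderiv ℝ (η z.1) z.2‖ := by
    simp only [hηd]
    exact ((hηs.continuous_fderiv (by simp)).clm_comp continuous_const).norm
  have hx0 : ∀ x ∈ S, ∀ᶠ z : ℝ × Em m in nhds ((0 : ℝ), x), ‖fderiv ℝ (η z.1) z.2‖ < 1 / 2 := by
    intro x _
    refine hcont.continuousAt.eventually_lt continuousAt_const ?_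
    have : η 0 = fun _ => 0 := funext h0
    simp [this]
  obtain ⟨δ, hδ, h2⟩ := Metric.eventually_nhds_iff.1
    (hS.eventually_forall_of_forall_eventually
      (P := fun s x => ‖fderiv ℝ (η s) x‖ < 1 / 2) hx0)
  refine ⟨δ, hδ, fun s hs x => ?_⟩
  by_cases hx : x ∈ S
  · exact (h2 (by simpa using hs) x hx).le
  · have : η s =ᶠ[nhds x] fun _ => 0 := by
      filter_upwards [hS.isClosed.isOpen_compl.mem_nhds hx] with y hy
      exact hout s y hy
    rw [this.fderiv_eq]
    simp

/-- A globally smooth, compactly supported vector field that is tangential to the hyperplane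
`xᵐ = 0` and to the sphere `|x| = R` is, up to a positive factor, the initial velocity of a smooth
family of diffeomorphisms preserving the half-ball and its boundary. -/
theorem exists_tangential_family (hm : 0 < m) (hR : 0 < R) {ξ : Em m → Em m}
    (hξ : ContDiff ℝ ∞ ξ) (hc : HasCompactSupport ξ)
    (h₁ : ∀ x, lastCLM m x = 0 → lastCLM m (ξ x) = 0) (h₂ : ∀ x, ‖x‖ = R → ⟪ξ x, x⟫ = 0) :
    ∃ δ : ℝ, 0 < δ ∧ ∃ φ ψ : ℝ → Em m → Em m, ContDiff ℝ ∞ (fun z : ℝ × Em m => φ z.1 z.2) ∧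
      ContDiff ℝ ∞ (fun z : ℝ × Em m => ψ z.1 z.2) ∧ (∀ t x, ψ t (φ t x) = x) ∧
      (∀ t x, φ t (ψ t x) = x) ∧ (∀ x, φ 0 x = x) ∧
      (∀ x, HasDerivAt (fun t => φ t x) (δ • ξ x) 0) ∧
      (∀ t x, φ t x ∈ openHalfBall m R ↔ x ∈ openHalfBall m R) ∧
      (∀ t x, φ t x ∈ closedHalfBall m R ↔ x ∈ closedHalfBall m R) := by
  set a : ℝ → Em m → ℝ := fun s x => (√(1 + s ^ 2 * ‖ξ x‖ ^ 2 / R ^ 2))⁻¹ with ha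
  have hpos : ∀ s x, 0 < 1 + s ^ 2 * ‖ξ x‖ ^ 2 / R ^ 2 := fun s x => by positivity
  have hapos : ∀ s x, 0 < a s x := fun s x => inv_pos.2 (Real.sqrt_pos.2 (hpos s x))
  set η : ℝ → Em m → Em m := fun s x => a s x • (x + s • ξ x) - x with hη
  have hξ2 : ContDiff ℝ ∞ (fun z : ℝ × Em m => ξ z.2) := hξ.comp contDiff_snd
  have hηs : ContDiff ℝ ∞ (fun z : ℝ × Em m => η z.1 z.2) := by
    have h1 : ContDiff ℝ ∞ (fun z : ℝ × Em m => 1 + z.1 ^ 2 * ‖ξ z.2‖ ^ 2 / R ^ 2) :=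
      contDiff_const.add (((contDiff_fst.pow 2).mul (hξ2.norm_sq ℝ)).div_const _)
    have h2 : ContDiff ℝ ∞ (fun z : ℝ × Em m => a z.1 z.2) :=
      (h1.sqrt fun z => (hpos z.1 z.2).ne').inv
        fun z => (Real.sqrt_pos.2 (hpos z.1 z.2)).ne'
    exact (h2.smul (contDiff_snd.add (contDiff_fst.smul hξ2))).sub contDiff_snd
  have hη0 : ∀ x, η 0 x = 0 := fun x => by simp [hη, ha]
  have hηout : ∀ s x, ξ x = 0 → η s x = 0 := fun s x hx => by simp [hη, ha, hx]
  obtain ⟨δ₁, hδ₁, hsmall⟩ := exists_fderiv_small hηs hη0 hc.isCompact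
    fun s x hx => hηout s x (image_eq_zero_of_notMem_tsupport hx)
  obtain ⟨L, hL⟩ := hξ.lipschitzWith_of_hasCompactSupport hc (by simp)
  have hfs : ContDiff ℝ ∞ (fun x => ⟪ξ x, x⟫) := hξ.inner ℝ contDiff_id
  have hfc : HasCompactSupport (fun x => ⟪ξ x, x⟫) :=
    hc.mono fun x hx h => hx (by simp [h])
  obtain ⟨C, hC⟩ := hfs.lipschitzWith_of_hasCompactSupport hfc (by simp)
  have hlast : ∀ x : Em m, |lastCLM m x| ≤ ‖x‖ := fun x => by
    rw [← inner_lastVec]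
    simpa [norm_lastVec hm] using abs_real_inner_le_norm (lastVec m) x
  have hξl : ∀ x, |lastCLM m (ξ x)| ≤ L * |lastCLM m x| := by
    intro x
    have hz := h₁ (x - lastCLM m x • lastVec m) (by simp [lastCLM_lastVec hm])
    have h := hL.dist_le_mul x (x - lastCLM m x • lastVec m)
    rw [dist_eq_norm, dist_eq_norm, sub_sub_cancel, norm_smul, norm_lastVec hm, mul_one,
      Real.norm_eq_abs] at h
    refine le_trans ?_ h
    have := hlast (ξ x - ξ (x - lastCLM m x • lastVec m))
    rwa [map_sub, hz, sub_zero] at this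
  have hξr : ∀ x, |⟪ξ x, x⟫| ≤ C * |R - ‖x‖| := by
    intro x
    rcases eq_or_ne x 0 with rfl | hx
    · simp only [inner_zero_right, abs_zero]; positivity
    have hx' := norm_pos_iff.2 hx
    have hz := h₂ ((R / ‖x‖) • x) (by
      rw [norm_smul, Real.norm_of_nonneg (by positivity)]; field_simp)
    have h := hC.dist_le_mul x ((R / ‖x‖) • x)
    rw [dist_eq_norm, dist_eq_norm, hz, sub_zero, Real.norm_eq_abs] at h
    refine h.trans_eq ?_
    congr 1
    rw [show x - (R / ‖x‖) • x = (1 - R / ‖x‖) • x by rw [sub_smul, one_smul], norm_smul,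
      Real.norm_eq_abs, abs_sub_comm R, ← abs_of_pos hx', ← abs_mul, abs_of_pos hx', sub_mul,
      one_mul, div_mul_cancel₀ _ hx'.ne']
  set δ : ℝ := min (δ₁ / 2) (min (1 / (2 * (L + 1))) (R / (4 * (C + 1)))) with hδ
  have hδpos : 0 < δ := by
    simp only [hδ, lt_min_iff]
    refine ⟨by positivity, by positivity, by positivity⟩
  have hδ1 : δ < δ₁ := (min_le_left _ _).trans_lt (by linarith)
  have hδ2 : δ * L ≤ 1 / 2 := by
    have : δ ≤ 1 / (2 * ((L : ℝ) + 1)) := (min_le_right _ _).trans (min_le_left _ _)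
    rw [le_div_iff₀ (by positivity)] at this
    nlinarith
  have hδ3 : δ * C ≤ R / 4 := by
    have : δ ≤ R / (4 * ((C : ℝ) + 1)) := (min_le_right _ _).trans (min_le_right _ _)
    rw [le_div_iff₀ (by positivity)] at this
    nlinarith
  have hsin : ∀ t, |δ * Real.sin t| ≤ δ := fun t => by
    rw [abs_mul, abs_of_pos hδpos]
    exact mul_le_of_le_one_right hδpos.le (Real.abs_sin_le_one t)
  set φ : ℝ → Em m → Em m := fun t x => x + η (δ * Real.sin t) x with hφ
  have hφs : ContDiff ℝ ∞ (fun z : ℝ × Em m => φ z.1 z.2) := by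
    refine contDiff_snd.add (hηs.comp (f := fun z : ℝ × Em m => (δ * Real.sin z.1, z.2)) ?_)
    exact (contDiff_const.mul (Real.contDiff_sin.comp contDiff_fst)).prodMk contDiff_snd
  have hφl : ∀ t, LipschitzWith (1 / 2) (fun x => φ t x - x) := by
    intro t
    have : (fun x => φ t x - x) = η (δ * Real.sin t) := by ext1 x; simp [hφ]
    rw [this]
    refine lipschitzWith_of_nnnorm_fderiv_le (𝕜 := ℝ)
      (fun x => ((hηs.comp (contDiff_prodMk_right (δ * Real.sin t))).differentiable
        (by simp)).differentiableAt) fun x => ?_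
    rw [← NNReal.coe_le_coe]
    push_cast
    exact hsmall _ ((hsin t).trans_lt hδ1) x
  obtain ⟨ψ, hψs, hψφ, hφψ⟩ := exists_contDiff_inverse φ hφs hφl
  have hφe : ∀ t x, φ t x
      = a (δ * Real.sin t) x • (x + (δ * Real.sin t) • ξ x) := fun t x => by simp [hφ, hη]
  have hlc : ∀ t x, lastCLM m (φ t x) = a (δ * Real.sin t) x *
      (lastCLM m x + (δ * Real.sin t) * lastCLM m (ξ x)) := fun t x => by simp [hφe, mul_add]
  have hbl : ∀ t x, |(δ * Real.sin t) * lastCLM m (ξ x)| ≤ |lastCLM m x| / 2 := by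
    intro t x
    rw [abs_mul]
    calc _ ≤ δ * (L * |lastCLM m x|) := by gcongr; exacts [hsin t, hξl x]
      _ = δ * L * |lastCLM m x| := by ring
      _ ≤ 1 / 2 * |lastCLM m x| := by gcongr
      _ = _ := by ring
  have hl1 : ∀ t x, 0 < lastCLM m (φ t x) ↔ 0 < lastCLM m x := fun t x => by
    rw [hlc, mul_pos_iff_of_pos_left (hapos _ _), pos_add_iff (hbl t x)]
  have hl2 : ∀ t x, 0 ≤ lastCLM m (φ t x) ↔ 0 ≤ lastCLM m x := fun t x => by
    rw [hlc, mul_nonneg_iff_of_pos_left (hapos _ _), nonneg_add_iff (hbl t x)]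
  have hn : ∀ t x, R ^ 2 - ‖φ t x‖ ^ 2 = a (δ * Real.sin t) x ^ 2 *
      ((R ^ 2 - ‖x‖ ^ 2) + (-2 * (δ * Real.sin t) * ⟪ξ x, x⟫)) := by
    intro t x
    have ha2 : a (δ * Real.sin t) x ^ 2
        = (1 + (δ * Real.sin t) ^ 2 * ‖ξ x‖ ^ 2 / R ^ 2)⁻¹ := by
      rw [ha, inv_pow, Real.sq_sqrt (hpos _ _).le]
    rw [hφe, norm_smul, mul_pow, Real.norm_eq_abs, sq_abs, ha2, norm_add_sq_real, norm_smul, Real.norm_eq_abs,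
      inner_smul_right, real_inner_comm, mul_pow |δ * _|, sq_abs]
    have := (hpos (δ * Real.sin t) x).ne'
    field_simp
    ring
  have hbn : ∀ t x, |(-2 * (δ * Real.sin t) * ⟪ξ x, x⟫)| ≤ |R ^ 2 - ‖x‖ ^ 2| / 2 := by
    intro t x
    have hx0 := norm_nonneg x
    rw [abs_mul, abs_mul]
    calc _ ≤ |(-2 : ℝ)| * δ * (C * |R - ‖x‖|) := by gcongr; exacts [hsin t, hξr x]
      _ = 2 * (δ * C) * |R - ‖x‖| := by rw [abs_neg, abs_two]; ring
      _ ≤ 2 * (R / 4) * |R - ‖x‖| := by gcongr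
      _ ≤ (R + ‖x‖) / 2 * |R - ‖x‖| := by gcongr; linarith
      _ = |R ^ 2 - ‖x‖ ^ 2| / 2 := by
        rw [sq_sub_sq, abs_mul, abs_of_nonneg (by linarith : 0 ≤ R + ‖x‖)]; ring
  have hn1 : ∀ t x, ‖φ t x‖ < R ↔ ‖x‖ < R := fun t x => by
    rw [← sq_lt_sq₀ (norm_nonneg _) hR.le, ← sub_pos, hn,
      mul_pos_iff_of_pos_left (pow_pos (hapos _ _) 2), pos_add_iff (hbn t x), sub_pos,
      sq_lt_sq₀ (norm_nonneg _) hR.le]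
  have hn2 : ∀ t x, ‖φ t x‖ ≤ R ↔ ‖x‖ ≤ R := fun t x => by
    rw [← sq_le_sq₀ (norm_nonneg _) hR.le, ← sub_nonneg, hn,
      mul_nonneg_iff_of_pos_left (pow_pos (hapos _ _) 2), nonneg_add_iff (hbn t x), sub_nonneg,
      sq_le_sq₀ (norm_nonneg _) hR.le]
  refine ⟨δ, hδpos, φ, ψ, hφs, hψs, hψφ, hφψ, fun x => by simp [hφ, hη0], fun x => ?_,
    fun t x => and_congr (hn1 t x) (hl1 t x), fun t x => and_congr (hn2 t x) (hl2 t x)⟩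
  have hs : HasDerivAt (fun t => δ * Real.sin t) δ 0 := by
    simpa using (Real.hasDerivAt_sin 0).const_mul δ
  have ha' : HasDerivAt (fun t => a (δ * Real.sin t) x) 0 0 := by
    have h1 : HasDerivAt (fun t => 1 + (δ * Real.sin t) ^ 2 * ‖ξ x‖ ^ 2 / R ^ 2) 0 0 := by
      simpa using (((hs.pow 2).mul_const (‖ξ x‖ ^ 2)).div_const (R ^ 2)).const_add 1
    have h2 := (h1.sqrt (hpos _ _).ne').inv (Real.sqrt_pos.2 (hpos _ _)).ne'
    exact h2.congr_deriv (by simp)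
  have hv : HasDerivAt (fun t => x + (δ * Real.sin t) • ξ x) (δ • ξ x) 0 :=
    (hs.smul_const (ξ x)).const_add x
  simp only [hφe]
  exact (ha'.smul hv).congr_deriv (by simp [ha])

end HalfBall

section Operators

open scoped ContDiff

variable {m n : ℕ} {γ : Em m → Matrix (Fin m) (Fin m) ℝ}

/-- The `i`-th standard basis vector. -/
abbrev stdVec {m : ℕ} (i : Fin m) : Em m := EuclideanSpace.single i 1

theorem sum_smul_stdVec (v : Em m) : ∑ i, v i • stdVec i = v := by
  ext j
  simp [stdVec, Finset.sum_apply, Pi.single_apply]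

theorem contDiff_pd {F : Type} [NormedAddCommGroup F] [NormedSpace ℝ F] {f : Em m → F}
    (hf : ContDiff ℝ ∞ f) (i : Fin m) : ContDiff ℝ ∞ (pd i f) :=
  (hf.fderiv_right (m := ∞) (by simp)).clm_apply contDiff_const

theorem contDiff_det {A : Em m → Matrix (Fin m) (Fin m) ℝ}
    (hA : ∀ i j, ContDiff ℝ ∞ (fun y => A y i j)) : ContDiff ℝ ∞ (fun y => (A y).det) := by
  simp only [Matrix.det_apply]
  exact ContDiff.sum fun σ _ => (contDiff_prod fun i _ => hA _ _).const_smul _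

theorem contDiff_ginv (hγ : ∀ i j, ContDiff ℝ ∞ (fun y => γ y i j)) (hpos : ∀ x, (γ x).PosDef)
    (i j : Fin m) : ContDiff ℝ ∞ (fun x => ginv γ x i j) := by
  have : (fun x => ginv γ x i j) = fun x => (γ x).det⁻¹ * (γ x).adjugate i j := by
    ext x
    simp [ginv, Matrix.inv_def]
  rw [this]
  refine ((contDiff_det hγ).inv fun x => (hpos x).det_pos.ne').mul ?_
  simp only [Matrix.adjugate_apply]
  refine contDiff_det fun k l => ?_
  by_cases hk : k = j
  · subst hk
    simp only [Matrix.updateRow_self]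
    exact contDiff_const
  · simp only [Matrix.updateRow_ne hk]
    exact hγ k l

theorem contDiff_sqg (hγ : ∀ i j, ContDiff ℝ ∞ (fun y => γ y i j)) (hpos : ∀ x, (γ x).PosDef) :
    ContDiff ℝ ∞ (sqg γ) :=
  (contDiff_det hγ).sqrt fun x => (hpos x).det_pos.ne'

theorem sqg_pos (hpos : ∀ x, (γ x).PosDef) (x : Em m) : 0 < sqg γ x :=
  Real.sqrt_pos.2 (hpos x).det_pos

theorem ginv_symm (hsymm : ∀ x, (γ x).IsSymm) (x : Em m) (i j : Fin m) :
    ginv γ x i j = ginv γ x j i := by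
  have : (ginv γ x).IsSymm := by
    rw [ginv, Matrix.IsSymm, Matrix.transpose_nonsing_inv, (hsymm x).eq]
  exact this.apply j i

theorem contDiff_christoffel (hγ : ∀ i j, ContDiff ℝ ∞ (fun y => γ y i j))
    (hpos : ∀ x, (γ x).PosDef) (k i j : Fin m) : ContDiff ℝ ∞ (christoffel γ k i j) := by
  unfold christoffel
  exact contDiff_const.mul (ContDiff.sum fun l _ => (contDiff_ginv hγ hpos k l).mul
    (((contDiff_pd (hγ j l) i).sub (contDiff_pd (hγ i j) l)).add (contDiff_pd (hγ i l) j)))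

/-- The contracted Christoffel symbols `γ^{ij}Γ^k_{ij}`. -/
def chrSum (γ : Em m → Matrix (Fin m) (Fin m) ℝ) (k : Fin m) (x : Em m) : ℝ :=
  ∑ i, ∑ j, ginv γ x i j * christoffel γ k i j x

/-- The vector with components `γ^{ij}Γ^k_{ij}`. -/
def chrVec (γ : Em m → Matrix (Fin m) (Fin m) ℝ) (x : Em m) : Em m :=
  ∑ k, chrSum γ k x • stdVec k

theorem contDiff_chrSum (hγ : ∀ i j, ContDiff ℝ ∞ (fun y => γ y i j))
    (hpos : ∀ x, (γ x).PosDef) (k : Fin m) : ContDiff ℝ ∞ (chrSum γ k) :=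
  ContDiff.sum fun i _ => ContDiff.sum fun j _ =>
    (contDiff_ginv hγ hpos i j).mul (contDiff_christoffel hγ hpos k i j)

theorem contDiff_chrVec (hγ : ∀ i j, ContDiff ℝ ∞ (fun y => γ y i j))
    (hpos : ∀ x, (γ x).PosDef) : ContDiff ℝ ∞ (chrVec γ) :=
  ContDiff.sum fun k _ => (contDiff_chrSum hγ hpos k).smul contDiff_const

theorem pd_pd_eq {f : Em m → Em n} {x : Em m} (hf : DifferentiableAt ℝ (fderiv ℝ f) x)
    (i j : Fin m) : pd i (pd j f) x = fderiv ℝ (fderiv ℝ f) x (stdVec i) (stdVec j) := by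
  unfold pd
  rw [fderiv_clm_apply hf (differentiableAt_const _)]
  simp

theorem lapB_eq {f : Em m → Em n} {x : Em m} (hf : DifferentiableAt ℝ (fderiv ℝ f) x) :
    lapB γ f x = (∑ i, ∑ j, ginv γ x i j • fderiv ℝ (fderiv ℝ f) x (stdVec i) (stdVec j))
      - fderiv ℝ f x (chrVec γ x) := by
  have h : ∀ k, pd k f x = fderiv ℝ f x (stdVec k) := fun _ => rfl
  simp only [lapB, pd_pd_eq hf, h, smul_sub, Finset.sum_sub_distrib, chrVec, chrSum, map_sum,
    map_smul, Finset.sum_smul, Finset.smul_sum, smul_smul]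
  congr 1
  rw [Finset.sum_comm_cycle]

/-- Second order chain rule. -/
theorem fderiv_fderiv_comp {U : Set (Em m)} (hU : IsOpen U) {w : Em m → Em n} {f : Em m → Em m}
    (hf : ContDiff ℝ ∞ f) (hfU : ∀ x ∈ U, f x ∈ U) (hw : ∀ x ∈ U, DifferentiableAt ℝ w x)
    (hw2 : ∀ x ∈ U, DifferentiableAt ℝ (fderiv ℝ w) x) {x : Em m} (hx : x ∈ U) :
    fderiv ℝ (fun y => w (f y)) x = (fderiv ℝ w (f x)).comp (fderiv ℝ f x) ∧
    DifferentiableAt ℝ (fderiv ℝ (fun y => w (f y))) x ∧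
    ∀ v v', fderiv ℝ (fderiv ℝ (fun y => w (f y))) x v v'
      = fderiv ℝ (fderiv ℝ w) (f x) (fderiv ℝ f x v) (fderiv ℝ f x v')
        + fderiv ℝ w (f x) (fderiv ℝ (fderiv ℝ f) x v v') := by
  have hfd : Differentiable ℝ f := hf.differentiable (by simp)
  have hfd2 : Differentiable ℝ (fderiv ℝ f) :=
    (hf.fderiv_right (m := ∞) (by simp)).differentiable (by simp)
  have h1 : ∀ y ∈ U, fderiv ℝ (fun y => w (f y)) y = (fderiv ℝ w (f y)).comp (fderiv ℝ f y) :=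
    fun y hy => fderiv_comp y (hw _ (hfU y hy)) (hfd y)
  have h2 : HasFDerivAt (fun y => (fderiv ℝ w (f y)).comp (fderiv ℝ f y)) _ x :=
    (((hw2 _ (hfU x hx)).hasFDerivAt.comp x (hfd x).hasFDerivAt)).clm_comp (hfd2 x).hasFDerivAt
  have h3 := h2.congr_of_eventuallyEq (Filter.eventuallyEq_of_mem (hU.mem_nhds hx) h1)
  refine ⟨h1 x hx, h3.differentiableAt, fun v v' => ?_⟩
  rw [h3.fderiv]
  simp [add_comm]

theorem lapB_comp {U : Set (Em m)} (hU : IsOpen U) {w : Em m → Em n} {f : Em m → Em m}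
    (hf : ContDiff ℝ ∞ f) (hfU : ∀ x ∈ U, f x ∈ U) (hw : ∀ x ∈ U, DifferentiableAt ℝ w x)
    (hw2 : ∀ x ∈ U, DifferentiableAt ℝ (fderiv ℝ w) x) {x : Em m} (hx : x ∈ U) :
    lapB γ (fun y => w (f y)) x = (∑ i, ∑ j, ginv γ x i j •
        fderiv ℝ (fderiv ℝ w) (f x) (fderiv ℝ f x (stdVec i)) (fderiv ℝ f x (stdVec j)))
      + fderiv ℝ w (f x) (lapB γ f x) := by
  obtain ⟨h1, h2, h3⟩ := fderiv_fderiv_comp hU hf hfU hw hw2 hx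
  rw [lapB_eq h2, h1, lapB_eq
    ((hf.fderiv_right (m := ∞) (by simp)).differentiable (by simp)).differentiableAt]
  simp only [h3, smul_add, Finset.sum_add_distrib, map_sub, map_sum, map_smul,
    ContinuousLinearMap.comp_apply]
  abel

end Operators

section Det

variable {m : ℕ}

theorem hasDerivAt_det_one {A : ℝ → Matrix (Fin m) (Fin m) ℝ} {A' : Matrix (Fin m) (Fin m) ℝ}
    (hA : ∀ i j, HasDerivAt (fun t => A t i j) (A' i j) 0) (h0 : A 0 = 1) :
    HasDerivAt (fun t => (A t).det) A'.trace 0 := by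
  let d : (Fin m → Fin m → ℝ) → ℝ := fun M => (Matrix.of M).det
  have hd : ContDiff ℝ 1 d := by
    simp only [d, Matrix.det_apply]
    refine ContDiff.sum fun σ _ => (contDiff_prod fun i _ => ?_).const_smul _
    exact contDiff_apply_apply ℝ ℝ (σ i) i
  have hA1 : HasDerivAt (fun t i j => A t i j) A' 0 :=
    hasDerivAt_pi.2 fun i => hasDerivAt_pi.2 fun j => hA i j
  have h1 := ((hd.differentiable (by simp)) (A 0)).hasFDerivAt.comp_hasDerivAt 0 hA1
  refine h1.congr_deriv ?_
  have hB : HasDerivAt (fun t : ℝ => (fun i j => (1 + t • A' : Matrix (Fin m) (Fin m) ℝ) i j)) A' 0 :=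
    hasDerivAt_pi.2 fun i => hasDerivAt_pi.2 fun j => by
      simpa using ((hasDerivAt_id (0 : ℝ)).mul_const (A' i j)).const_add
        ((1 : Matrix (Fin m) (Fin m) ℝ) i j)
  have h2 := ((hd.differentiable (by simp)) (A 0)).hasFDerivAt.comp_hasDerivAt_of_eq 0 hB
    (by rw [h0]; ext; simp)
  have h3 : HasDerivAt (fun t : ℝ => (1 + t • A').det) A'.trace 0 := by
    rw [show (fun t : ℝ => (1 + t • A').det) = _ from funext fun t => Matrix.det_one_add_smul t A']
    have h4 := (Polynomial.hasDerivAt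
      ((1 + (Polynomial.X : Polynomial ℝ) • A'.map Polynomial.C).det.divX.divX) (0 : ℝ)).mul
        ((hasDerivAt_id (0 : ℝ)).pow 2)
    have h5 := (((hasDerivAt_id (0 : ℝ)).const_mul A'.trace).const_add 1).add h4
    exact h5.congr_deriv (by simp)
  exact h2.unique h3

end Det

section Flow

open scoped ContDiff

variable {m : ℕ}

theorem hasDerivAt_comp_flow {F : Type} [NormedAddCommGroup F] [NormedSpace ℝ F]
    {f : ℝ → Em m → F} (hf : ContDiff ℝ ∞ (fun z : ℝ × Em m => f z.1 z.2)) {c : ℝ → Em m}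
    {y v : Em m} {f' : F} (hc : HasDerivAt c v 0) (hc0 : c 0 = y)
    (hf' : HasDerivAt (fun t => f t y) f' 0) :
    HasDerivAt (fun t => f t (c t)) (f' + fderiv ℝ (f 0) y v) 0 := by
  have hd := (hf.differentiable (by simp) ((0 : ℝ), y)).hasFDerivAt
  have h1 := hd.comp_hasDerivAt_of_eq (0 : ℝ) ((hasDerivAt_id (0 : ℝ)).prodMk hc) (by simp [hc0])
  have h2 := hd.comp_hasDerivAt_of_eq (0 : ℝ) ((hasDerivAt_id (0 : ℝ)).prodMk
    (hasDerivAt_const (0 : ℝ) y)) (by simp)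
  have h3 := hd.comp y (hasFDerivAt_prodMk_right (0 : ℝ) y)
  have h2' := h2.unique hf'
  have h3' : fderiv ℝ (f 0) y = _ := h3.fderiv
  refine h1.congr_deriv ?_
  rw [h3', ← h2']
  simp only [ContinuousLinearMap.comp_apply, ContinuousLinearMap.inr_apply, ← map_add,
    Prod.mk_add_mk, add_zero, zero_add]

theorem hasDerivAt_fderiv_flow {F : Type} [NormedAddCommGroup F] [NormedSpace ℝ F]
    {f : ℝ → Em m → F} (hf : ContDiff ℝ ∞ (fun z : ℝ × Em m => f z.1 z.2)) {X : Em m → F}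
    (hX : ∀ x, HasDerivAt (fun t => f t x) (X x) 0) (x : Em m) :
    HasDerivAt (fun t => fderiv ℝ (f t) x) (fderiv ℝ X x) 0 ∧
    HasDerivAt (fun t => fderiv ℝ (fderiv ℝ (f t)) x) (fderiv ℝ (fderiv ℝ X) x) 0 := by
  have hB : UniqueDiffOn ℝ (Metric.closedBall x 1) := uniqueDiffOn_convex (convex_closedBall _ _)
    ⟨x, by rw [interior_closedBall _ one_ne_zero]; simp⟩
  have h := diffFamily_of_contDiffOn (k := 2) (isCompact_closedBall x 1) hB
    (show (-1 : ℝ) < 1 by norm_num) (f := f) ((hf.of_le (WithTop.coe_le_coe.2 le_top)).contDiffOn)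
  have hx : x ∈ interior (Metric.closedBall x 1) := by
    rw [interior_closedBall _ one_ne_zero]; simp
  have h0 : (0 : ℝ) ∈ Set.Ioo (-1 : ℝ) 1 := by norm_num
  have hX' : (fun y => fderiv ℝ (fun z : ℝ × Em m => f z.1 z.2) (0, y) (1, 0)) = X := by
    ext1 y
    have hd := (hf.differentiable (by simp) ((0 : ℝ), y)).hasFDerivAt
    exact (hd.comp_hasDerivAt_of_eq (0 : ℝ) ((hasDerivAt_id (0 : ℝ)).prodMk
      (hasDerivAt_const (0 : ℝ) y)) (by simp)).unique (hX y)
  have h1 := h.2.2.base.deriv 0 h0 x hx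
  have h2 := h.2.2.2.2.base.deriv 0 h0 x hx
  rw [← hX']
  exact ⟨h1, h2⟩

/-- A smooth family of diffeomorphisms `φ t` with inverses `ψ t`, starting at the identity with
velocity `X`. -/
structure IsFlow (φ ψ : ℝ → Em m → Em m) (X : Em m → Em m) : Prop where
  smooth : ContDiff ℝ ∞ (fun z : ℝ × Em m => φ z.1 z.2)
  smooth_inv : ContDiff ℝ ∞ (fun z : ℝ × Em m => ψ z.1 z.2)
  left_inv : ∀ t x, ψ t (φ t x) = x
  right_inv : ∀ t x, φ t (ψ t x) = x
  zero : ∀ x, φ 0 x = x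
  deriv : ∀ x, HasDerivAt (fun t => φ t x) (X x) 0
  smooth_vel : ContDiff ℝ ∞ X

namespace IsFlow

variable {φ ψ : ℝ → Em m → Em m} {X : Em m → Em m}

theorem inv_zero (h : IsFlow φ ψ X) (x : Em m) : ψ 0 x = x := by
  rw [← h.zero (ψ 0 x), h.right_inv]

theorem smooth_at (h : IsFlow φ ψ X) (t : ℝ) : ContDiff ℝ ∞ (φ t) :=
  h.smooth.comp (contDiff_prodMk_right t)

theorem smooth_inv_at (h : IsFlow φ ψ X) (t : ℝ) : ContDiff ℝ ∞ (ψ t) :=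
  h.smooth_inv.comp (contDiff_prodMk_right t)

theorem deriv_inv (h : IsFlow φ ψ X) (y : Em m) : HasDerivAt (fun t => ψ t y) (-X y) 0 := by
  have hd : DifferentiableAt ℝ (fun t => ψ t y) 0 :=
    ((h.smooth_inv.comp (contDiff_prodMk_left y)).differentiable (by simp)).differentiableAt
  have h1 := hasDerivAt_comp_flow h.smooth hd.hasDerivAt (h.inv_zero y) (h.deriv y)
  simp only [h.right_inv] at h1
  have h2 := h1.unique (hasDerivAt_const _ _)
  rw [show φ 0 = fun x => x from funext h.zero, fderiv_fun_id, ContinuousLinearMap.id_apply] at h2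
  rw [← eq_neg_of_add_eq_zero_right h2]
  exact hd.hasDerivAt

theorem hasDerivAt_comp (h : IsFlow φ ψ X) {F : Type} [NormedAddCommGroup F] [NormedSpace ℝ F]
    {f : Em m → F} (hf : ContDiff ℝ ∞ f) (y : Em m) :
    HasDerivAt (fun t => f (ψ t y)) (-fderiv ℝ f y (X y)) 0 := by
  simpa using hasDerivAt_comp_flow (f := fun _ => f) (hf.comp contDiff_snd) (h.deriv_inv y)
    (h.inv_zero y) (hasDerivAt_const _ _)

theorem smooth_fderiv (h : IsFlow φ ψ X) :
    ContDiff ℝ ∞ (fun z : ℝ × Em m => fderiv ℝ (φ z.1) z.2) :=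
  ContDiff.fderiv (f := fun (z : ℝ × Em m) x => φ z.1 x) (n := ∞)
    (h.smooth.comp ((contDiff_fst.comp contDiff_fst).prodMk contDiff_snd)) contDiff_snd (by simp)

theorem smooth_fderiv_inv (h : IsFlow φ ψ X) :
    ContDiff ℝ ∞ (fun z : ℝ × Em m => fderiv ℝ (ψ z.1) z.2) :=
  ContDiff.fderiv (f := fun (z : ℝ × Em m) x => ψ z.1 x) (n := ∞)
    (h.smooth_inv.comp ((contDiff_fst.comp contDiff_fst).prodMk contDiff_snd)) contDiff_snd
    (by simp)

theorem smooth_fderiv_fderiv (h : IsFlow φ ψ X) :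
    ContDiff ℝ ∞ (fun z : ℝ × Em m => fderiv ℝ (fderiv ℝ (φ z.1)) z.2) :=
  ContDiff.fderiv (f := fun (z : ℝ × Em m) x => fderiv ℝ (φ z.1) x) (n := ∞)
    (h.smooth_fderiv.comp ((contDiff_fst.comp contDiff_fst).prodMk contDiff_snd)) contDiff_snd
    (by simp)

theorem fderiv_zero (h : IsFlow φ ψ X) : fderiv ℝ (φ 0) = fun _ => ContinuousLinearMap.id ℝ _ := by
  rw [show φ 0 = fun x => x from funext h.zero]
  ext1 x
  exact fderiv_fun_id

theorem hasDerivAt_fderiv (h : IsFlow φ ψ X) (y v : Em m) :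
    HasDerivAt (fun t => fderiv ℝ (φ t) (ψ t y) v) (fderiv ℝ X y v) 0 := by
  have := hasDerivAt_comp_flow h.smooth_fderiv (h.deriv_inv y) (h.inv_zero y)
    (hasDerivAt_fderiv_flow h.smooth h.deriv y).1
  rw [h.fderiv_zero] at this
  simpa using this.clm_apply (hasDerivAt_const _ v)

variable {γ : Em m → Matrix (Fin m) (Fin m) ℝ}

theorem lapB_eq (h : IsFlow φ ψ X) (t : ℝ) (x : Em m) :
    lapB γ (φ t) x
      = (∑ i, ∑ j, ginv γ x i j • fderiv ℝ (fderiv ℝ (φ t)) x (stdVec i) (stdVec j))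
      - fderiv ℝ (φ t) x (chrVec γ x) :=
  _root_.lapB_eq ((((h.smooth_at t).fderiv_right (m := ∞) (by simp)).differentiable
    (by simp)).differentiableAt)

theorem smooth_lapB (h : IsFlow φ ψ X) (hγ : ∀ i j, ContDiff ℝ ∞ (fun y => γ y i j))
    (hpos : ∀ x, (γ x).PosDef) : ContDiff ℝ ∞ (fun z : ℝ × Em m => lapB γ (φ z.1) z.2) := by
  simp only [h.lapB_eq]
  refine (ContDiff.sum fun i _ => ContDiff.sum fun j _ =>
    ((contDiff_ginv hγ hpos i j).comp contDiff_snd).smul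
      ((h.smooth_fderiv_fderiv.clm_apply contDiff_const).clm_apply contDiff_const)).sub
    (h.smooth_fderiv.clm_apply ((contDiff_chrVec hγ hpos).comp contDiff_snd))

theorem lapB_zero (h : IsFlow φ ψ X) : lapB γ (φ 0) = fun x => -chrVec γ x := by
  ext1 x
  rw [h.lapB_eq, h.fderiv_zero]
  simp

theorem hasDerivAt_lapB (h : IsFlow φ ψ X) (hγ : ∀ i j, ContDiff ℝ ∞ (fun y => γ y i j))
    (hpos : ∀ x, (γ x).PosDef) (y : Em m) :
    HasDerivAt (fun t => lapB γ (φ t) (ψ t y))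
      (lapB γ X y + fderiv ℝ (chrVec γ) y (X y)) 0 := by
  have h0 : HasDerivAt (fun t => lapB γ (φ t) y) (lapB γ X y) 0 := by
    obtain ⟨h1, h2⟩ := hasDerivAt_fderiv_flow h.smooth h.deriv y
    simp only [h.lapB_eq]
    rw [_root_.lapB_eq ((h.smooth_vel.fderiv_right (m := ∞) (by simp)).differentiable
      (by simp)).differentiableAt]
    have h3 : ∀ i j : Fin m, HasDerivAt
        (fun t => ginv γ y i j • fderiv ℝ (fderiv ℝ (φ t)) y (stdVec i) (stdVec j))
        (ginv γ y i j • fderiv ℝ (fderiv ℝ X) y (stdVec i) (stdVec j)) 0 := fun i j => by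
      refine (((h2.clm_apply (hasDerivAt_const _ (stdVec i))).clm_apply
        (hasDerivAt_const _ (stdVec j))).const_smul (ginv γ y i j)).congr_deriv ?_
      simp
    refine (HasDerivAt.fun_sum fun i _ => HasDerivAt.fun_sum fun j _ => h3 i j).fun_sub ?_
    simpa using h1.clm_apply (hasDerivAt_const _ (chrVec γ y))
  have h1 := hasDerivAt_comp_flow (h.smooth_lapB hγ hpos) (h.deriv_inv y) (h.inv_zero y) h0
  rw [h.lapB_zero] at h1
  refine h1.congr_deriv ?_
  rw [fderiv_fun_neg]
  simp

/-- The determinant in terms of the matrix entries in the standard basis. -/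
theorem det_eq (A : Em m →L[ℝ] Em m) :
    A.det = (Matrix.of fun i j => A (stdVec j) i).det := by
  rw [ContinuousLinearMap.det, ← LinearMap.det_toMatrix (EuclideanSpace.basisFun (Fin m) ℝ).toBasis]
  congr 1

theorem det_pos (h : IsFlow φ ψ X) (t : ℝ) (y : Em m) : 0 < (fderiv ℝ (ψ t) y).det := by
  have hc : Continuous fun s => (fderiv ℝ (ψ s) y).det :=
    ContinuousLinearMap.continuous_det.comp
      (h.smooth_fderiv_inv.continuous.comp (Continuous.prodMk_left y))
  have hne : ∀ s, (fderiv ℝ (ψ s) y).det ≠ 0 := by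
    intro s
    have h1 : (fderiv ℝ (φ s) (ψ s y)).comp (fderiv ℝ (ψ s) y) = ContinuousLinearMap.id ℝ _ := by
      rw [← fderiv_comp y ((h.smooth_at s).differentiable (by simp)).differentiableAt
        ((h.smooth_inv_at s).differentiable (by simp)).differentiableAt,
        show φ s ∘ ψ s = fun x => x from funext (h.right_inv s)]
      exact fderiv_fun_id
    have h2 := congrArg ContinuousLinearMap.det h1
    intro h0
    rw [ContinuousLinearMap.det, ContinuousLinearMap.toLinearMap_comp, LinearMap.det_comp] at h2
    rw [ContinuousLinearMap.det] at h0
    rw [h0] at h2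
    simp [ContinuousLinearMap.det] at h2
  have h0 : 0 < (fderiv ℝ (ψ 0) y).det := by
    rw [show ψ 0 = fun x => x from funext h.inv_zero, fderiv_fun_id]
    simp [ContinuousLinearMap.det]
  by_contra! hneg
  obtain ⟨s, hs⟩ := mem_range_of_exists_le_of_exists_ge hc ⟨t, hneg⟩ ⟨0, h0.le⟩
  exact hne s hs

theorem smooth_det (h : IsFlow φ ψ X) :
    ContDiff ℝ ∞ (fun z : ℝ × Em m => (fderiv ℝ (ψ z.1) z.2).det) := by
  simp only [det_eq, Matrix.det_apply, Matrix.of_apply]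
  exact ContDiff.sum fun σ _ => (contDiff_prod fun i _ =>
    (EuclideanSpace.proj (𝕜 := ℝ) (σ i)).contDiff.comp
      (h.smooth_fderiv_inv.clm_apply contDiff_const)).const_smul _

theorem hasDerivAt_det (h : IsFlow φ ψ X) (y : Em m) :
    HasDerivAt (fun t => (fderiv ℝ (ψ t) y).det) (-∑ k, (fderiv ℝ X y (stdVec k)) k) 0 := by
  simp only [det_eq]
  have h1 := (hasDerivAt_fderiv_flow h.smooth_inv h.deriv_inv y).1
  rw [fderiv_fun_neg] at h1
  have h2 := hasDerivAt_det_one (A := fun t => Matrix.of fun i j => fderiv ℝ (ψ t) y (stdVec j) i)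
    (A' := Matrix.of fun i j => -(fderiv ℝ X y (stdVec j)) i) (fun i j => ?_) ?_
  · simpa [Matrix.trace] using h2
  · have h3 := h1.clm_apply (hasDerivAt_const _ (stdVec j))
    have h4 := (EuclideanSpace.proj (𝕜 := ℝ) i).hasFDerivAt.comp_hasDerivAt (0 : ℝ) h3
    exact h4.congr_deriv (by simp)
  · ext i j
    rw [show ψ 0 = fun x => x from funext h.inv_zero, fderiv_fun_id]
    simp [Matrix.one_apply]

theorem hasDerivAt_jac (h : IsFlow φ ψ X) (hγ : ∀ i j, ContDiff ℝ ∞ (fun y => γ y i j))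
    (hpos : ∀ x, (γ x).PosDef) (y : Em m) :
    HasDerivAt (fun t => (fderiv ℝ (ψ t) y).det * sqg γ (ψ t y))
      (-∑ k, pd k (fun x => sqg γ x * X x k) y) 0 := by
  have hX : DifferentiableAt ℝ X y := (h.smooth_vel.differentiable (by simp)).differentiableAt
  have hs : DifferentiableAt ℝ (sqg γ) y :=
    ((contDiff_sqg hγ hpos).differentiable (by simp)).differentiableAt
  refine ((h.hasDerivAt_det y).mul (h.hasDerivAt_comp (contDiff_sqg hγ hpos) y)).congr_deriv ?_
  have hk : ∀ k, pd k (fun x => sqg γ x * X x k) y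
      = sqg γ y * (fderiv ℝ X y (stdVec k)) k + X y k * fderiv ℝ (sqg γ) y (stdVec k) := by
    intro k
    have hXk : HasFDerivAt (fun x => X x k)
        ((EuclideanSpace.proj (𝕜 := ℝ) k).comp (fderiv ℝ X y)) y :=
      (EuclideanSpace.proj (𝕜 := ℝ) k).hasFDerivAt.comp y hX.hasFDerivAt
    rw [pd, (hs.hasFDerivAt.fun_mul hXk).fderiv]
    simp
  have h0 : (fderiv ℝ (ψ 0) y).det = 1 := by
    rw [show ψ 0 = fun x => x from funext h.inv_zero, fderiv_fun_id]
    simp [ContinuousLinearMap.det]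
  simp only [hk, h0, h.inv_zero, Finset.sum_add_distrib, ← Finset.mul_sum]
  conv_lhs => rw [← sum_smul_stdVec (X y)]
  simp only [map_sum, map_smul, smul_eq_mul]
  ring

end IsFlow
end Flow

section FirstVariation

open scoped ContDiff

variable {m n : ℕ} {γ : Em m → Matrix (Fin m) (Fin m) ℝ}

theorem lapB_congr {U : Set (Em m)} (hU : IsOpen U) {f f' : Em m → Em n}
    (h : ∀ y ∈ U, f y = f' y) {y : Em m} (hy : y ∈ U) : lapB γ f y = lapB γ f' y := by
  have h1 : ∀ i, ∀ z ∈ U, pd i f z = pd i f' z := fun i z hz => by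
    rw [pd, fderiv_eq_of_eqOn hU h hz, pd]
  have h2 : ∀ i j, pd i (pd j f) y = pd i (pd j f') y := fun i j => by
    rw [pd, fderiv_eq_of_eqOn hU (h1 j) hy, pd]
  simp only [lapB, h1 _ y hy, h2]

/-- The first variation of `Δ_γ u` along a flow with velocity `X`, where `T` is the variation
of the map itself. -/
def innerVec (γ : Em m → Matrix (Fin m) (Fin m) ℝ) (u T : Em m → Em n) (X : Em m → Em m)
    (y : Em m) : Em n :=
  (∑ i, ∑ j, (ginv γ y i j • (fderiv ℝ (fderiv ℝ u) y (fderiv ℝ X y (stdVec i)) (stdVec j)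
        + fderiv ℝ (fderiv ℝ u) y (stdVec i) (fderiv ℝ X y (stdVec j)))
      - fderiv ℝ (fun z => ginv γ z i j) y (X y) •
        fderiv ℝ (fderiv ℝ u) y (stdVec i) (stdVec j)))
    + fderiv ℝ u y (lapB γ X y + fderiv ℝ (chrVec γ) y (X y)) + lapB γ T y

/-- The first variation of the bienergy density. -/
def innerDens (γ : Em m → Matrix (Fin m) (Fin m) ℝ) (u T : Em m → Em n) (X : Em m → Em m)
    (y : Em m) : ℝ :=
  2 * (sqg γ y * ⟪lapB γ u y, innerVec γ u T X y⟫)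
    - ‖lapB γ u y‖ ^ 2 * ∑ k, pd k (fun x => sqg γ x * X x k) y

/-- A family with bounded `t`-derivative. -/
def BddCurve {F : Type} [NormedAddCommGroup F] [NormedSpace ℝ F] (I : Set ℝ) (U : Set (Em m))
    (p : ℝ → Em m → F) : Prop := ∃ p', BddDiffFamily I U p p'

namespace BddCurve

variable {F G : Type} [NormedAddCommGroup F] [NormedSpace ℝ F] [NormedAddCommGroup G]
  [NormedSpace ℝ G] {I : Set ℝ} {U : Set (Em m)}

theorem of_contDiffOn {K : Set (Em m)} (hK : IsCompact K) (hKu : UniqueDiffOn ℝ K) {a b : ℝ}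
    (hab : a < b) {f : ℝ → Em m → F}
    (hf : ContDiffOn ℝ 1 (fun z : ℝ × Em m => f z.1 z.2) (Set.Icc a b ×ˢ K)) :
    BddCurve (Set.Ioo a b) (interior K) f :=
  ⟨_, diffFamily_of_contDiffOn (k := 0) hK hKu hab (by simpa using hf)⟩

theorem of_contDiff {K : Set (Em m)} (hK : IsCompact K) (hKu : UniqueDiffOn ℝ K) {a b : ℝ}
    (hab : a < b) {f : ℝ → Em m → F} (hf : ContDiff ℝ ∞ (fun z : ℝ × Em m => f z.1 z.2)) :
    BddCurve (Set.Ioo a b) (interior K) f :=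
  of_contDiffOn hK hKu hab (hf.of_le (WithTop.coe_le_coe.2 le_top)).contDiffOn

theorem bilin {H : Type} [NormedAddCommGroup H] [NormedSpace ℝ H] (L : F →L[ℝ] G →L[ℝ] H)
    {p : ℝ → Em m → F} {q : ℝ → Em m → G} (hp : BddCurve I U p) (hq : BddCurve I U q) :
    BddCurve I U (fun t y => L (p t y) (q t y)) :=
  let ⟨_, hp⟩ := hp
  let ⟨_, hq⟩ := hq
  ⟨_, hp.bilin L hq⟩

theorem smul {p : ℝ → Em m → ℝ} {q : ℝ → Em m → F} (hp : BddCurve I U p) (hq : BddCurve I U q) :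
    BddCurve I U (fun t y => p t y • q t y) :=
  hp.bilin (ContinuousLinearMap.lsmul ℝ ℝ) hq

theorem clm_apply {p : ℝ → Em m → F →L[ℝ] G} {q : ℝ → Em m → F} (hp : BddCurve I U p)
    (hq : BddCurve I U q) : BddCurve I U (fun t y => p t y (q t y)) :=
  hp.bilin (ContinuousLinearMap.id ℝ _) hq

theorem inner {p q : ℝ → Em m → Em n} (hp : BddCurve I U p) (hq : BddCurve I U q) :
    BddCurve I U (fun t y => ⟪p t y, q t y⟫) :=
  hp.bilin (innerSL ℝ) hq

theorem add (hI : IsOpen I) (hU : IsOpen U) {p q : ℝ → Em m → F} (hp : BddCurve I U p)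
    (hq : BddCurve I U q) : BddCurve I U (fun t y => p t y + q t y) :=
  let ⟨_, hp⟩ := hp
  let ⟨_, hq⟩ := hq
  ⟨_, DiffFamily.add (k := 0) hI hU hp hq⟩

theorem sum {ι : Type} [Fintype ι] (hI : IsOpen I) (hU : IsOpen U) {p : ι → ℝ → Em m → F}
    (hp : ∀ i, BddCurve I U (p i)) : BddCurve I U (fun t y => ∑ i, p i t y) := by
  choose p' hp' using hp
  exact ⟨_, DiffFamily.sum (k := 0) Finset.univ hI hU fun i _ => hp' i⟩

end BddCurve

namespace IsFlow

variable {φ ψ : ℝ → Em m → Em m} {X : Em m → Em m}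

/-- `Δ_γ(w ∘ φ t)` at the point `ψ t y`. -/
def lapComp (γ : Em m → Matrix (Fin m) (Fin m) ℝ) (φ ψ : ℝ → Em m → Em m)
    (w : ℝ → Em m → Em n) (t : ℝ) (y : Em m) : Em n :=
  (∑ i, ∑ j, ginv γ (ψ t y) i j • fderiv ℝ (fderiv ℝ (w t)) y (fderiv ℝ (φ t) (ψ t y) (stdVec i))
    (fderiv ℝ (φ t) (ψ t y) (stdVec j))) + fderiv ℝ (w t) y (lapB γ (φ t) (ψ t y))

/-- The transformed bienergy density. -/
def energyDens (γ : Em m → Matrix (Fin m) (Fin m) ℝ) (φ ψ : ℝ → Em m → Em m)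
    (w : ℝ → Em m → Em n) (t : ℝ) (y : Em m) : ℝ :=
  ((fderiv ℝ (ψ t) y).det * sqg γ (ψ t y)) * ⟪lapComp γ φ ψ w t y, lapComp γ φ ψ w t y⟫

variable {U : Set (Em m)} {I : Set ℝ} {w w' : ℝ → Em m → Em n}

theorem setIntegral_lapB (h : IsFlow φ ψ X) (hU : IsOpen U)
    (hφU : ∀ t x, φ t x ∈ U ↔ x ∈ U) (hw : DiffFamily I U 2 w w') {t : ℝ} (ht : t ∈ I) :
    ∫ x in U, sqg γ x * ‖lapB γ (fun y => w t (φ t y)) x‖ ^ 2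
      = ∫ y in U, energyDens γ φ ψ w t y := by
  have hψU : ∀ x, ψ t x ∈ U ↔ x ∈ U := fun x => by rw [← hφU t, h.right_inv]
  have himg : ψ t '' U = U := by
    ext x
    constructor
    · rintro ⟨y, hy, rfl⟩
      exact (hψU y).2 hy
    · exact fun hx => ⟨φ t x, (hφU t x).2 hx, h.left_inv t x⟩
  have hinj : Set.InjOn (ψ t) U := fun x _ y _ hxy => by
    rw [← h.right_inv t x, hxy, h.right_inv]
  conv_lhs => rw [← himg]
  rw [integral_image_eq_integral_abs_det_fderiv_smul volume hU.measurableSet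
    (fun x _ => (((h.smooth_inv_at t).differentiable (by simp)) x).hasFDerivAt.hasFDerivWithinAt)
    hinj]
  refine setIntegral_congr_fun hU.measurableSet fun y hy => ?_
  simp only [energyDens]
  rw [abs_of_pos (h.det_pos t y), lapB_comp hU (h.smooth_at t) (fun x hx => (hφU t x).2 hx)
    (fun x hx => (hw.2.1 t ht x hx).1) (fun x hx => (hw.2.2.2.1 t ht x hx).1) ((hψU y).2 hy),
    h.right_inv, real_inner_self_eq_norm_sq, smul_eq_mul, mul_assoc]
  rfl

theorem exists_bddDiffFamily_energyDens (h : IsFlow φ ψ X)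
    (hγ : ∀ i j, ContDiff ℝ ∞ (fun y => γ y i j)) (hpos : ∀ x, (γ x).PosDef)
    {K : Set (Em m)} (hK : IsCompact K) (hKu : UniqueDiffOn ℝ K) {a b : ℝ} (hab : a < b)
    (hw : DiffFamily (Set.Ioo a b) (interior K) 2 w w') :
    ∃ H, BddDiffFamily (Set.Ioo a b) (interior K) (energyDens γ φ ψ w) H := by
  have hI : IsOpen (Set.Ioo a b) := isOpen_Ioo
  have hU : IsOpen (interior K) := isOpen_interior
  have hψ2 : ContDiff ℝ ∞ (fun z : ℝ × Em m => (z.1, ψ z.1 z.2)) :=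
    contDiff_fst.prodMk h.smooth_inv
  have hj : BddCurve (Set.Ioo a b) (interior K)
      (fun t y => (fderiv ℝ (ψ t) y).det * sqg γ (ψ t y)) :=
    BddCurve.of_contDiff hK hKu hab (h.smooth_det.mul ((contDiff_sqg hγ hpos).comp h.smooth_inv))
  have hc : ∀ i k, BddCurve (Set.Ioo a b) (interior K) (fun t y => ginv γ (ψ t y) i k) :=
    fun i k => BddCurve.of_contDiff hK hKu hab ((contDiff_ginv hγ hpos i k).comp h.smooth_inv)
  have hA : ∀ i, BddCurve (Set.Ioo a b) (interior K)
      (fun t y => fderiv ℝ (φ t) (ψ t y) (stdVec i)) := fun i =>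
    BddCurve.of_contDiff hK hKu hab ((h.smooth_fderiv.comp hψ2).clm_apply contDiff_const)
  have hB : BddCurve (Set.Ioo a b) (interior K) (fun t y => lapB γ (φ t) (ψ t y)) :=
    BddCurve.of_contDiff hK hKu hab (f := fun t y => lapB γ (φ t) (ψ t y))
      (ContDiff.comp (g := fun z : ℝ × Em m => lapB γ (φ z.1) z.2)
        (f := fun z : ℝ × Em m => (z.1, ψ z.1 z.2)) (h.smooth_lapB hγ hpos) hψ2)
  have hD1 : BddCurve (Set.Ioo a b) (interior K) (fun t y => fderiv ℝ (w t) y) :=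
    ⟨_, hw.2.2.base⟩
  have hD2 : BddCurve (Set.Ioo a b) (interior K) (fun t y => fderiv ℝ (fderiv ℝ (w t)) y) :=
    ⟨_, hw.2.2.2.2⟩
  have hQ : BddCurve (Set.Ioo a b) (interior K) (lapComp γ φ ψ w) :=
    (BddCurve.sum hI hU fun i => BddCurve.sum hI hU fun k =>
      (hc i k).smul ((hD2.clm_apply (hA i)).clm_apply (hA k))).add hI hU (hD1.clm_apply hB)
  exact hj.smul (hQ.inner hQ)

theorem hasDerivAt_energyDens (h : IsFlow φ ψ X)
    (hγ : ∀ i j, ContDiff ℝ ∞ (fun y => γ y i j)) (hpos : ∀ x, (γ x).PosDef)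
    (hU : IsOpen U) (h0 : (0 : ℝ) ∈ I) (hw : DiffFamily I U 2 w w') {u T : Em m → Em n}
    (hu : ∀ y ∈ U, w 0 y = u y) (hT : ∀ y ∈ U, w' 0 y = T y) {y : Em m} (hy : y ∈ U) :
    HasDerivAt (fun t => energyDens γ φ ψ w t y) (innerDens γ u T X y) 0 := by
  have hD1 : HasDerivAt (fun t => fderiv ℝ (w t) y) (fderiv ℝ T y) 0 := by
    have := hw.2.2.base.deriv 0 h0 y hy
    rwa [fderiv_eq_of_eqOn hU hT hy] at this
  have hT1 : ∀ z ∈ U, fderiv ℝ (w' 0) z = fderiv ℝ T z := fun z hz => fderiv_eq_of_eqOn hU hT hz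
  have hu1 : ∀ z ∈ U, fderiv ℝ (w 0) z = fderiv ℝ u z := fun z hz => fderiv_eq_of_eqOn hU hu hz
  have hD2 : HasDerivAt (fun t => fderiv ℝ (fderiv ℝ (w t)) y) (fderiv ℝ (fderiv ℝ T) y) 0 := by
    have := hw.2.2.2.2.base.deriv 0 h0 y hy
    rwa [fderiv_eq_of_eqOn hU hT1 hy] at this
  have hu2 : fderiv ℝ (fderiv ℝ (w 0)) y = fderiv ℝ (fderiv ℝ u) y := fderiv_eq_of_eqOn hU hu1 hy
  have hTd : DifferentiableAt ℝ (fderiv ℝ T) y :=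
    (hw.2.2.2.1 0 h0 y hy).2.congr_of_eventuallyEq
      (Filter.eventuallyEq_of_mem (hU.mem_nhds hy) fun z hz => (hT1 z hz).symm)
  have hud : DifferentiableAt ℝ (fderiv ℝ u) y :=
    (hw.2.2.2.1 0 h0 y hy).1.congr_of_eventuallyEq
      (Filter.eventuallyEq_of_mem (hU.mem_nhds hy) fun z hz => (hu1 z hz).symm)
  have hA0 : ∀ v, fderiv ℝ (φ 0) y v = v := fun v => by rw [h.fderiv_zero]; rfl
  have hB0 : lapB γ (φ 0) y = -chrVec γ y := by rw [h.lapB_zero]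
  have hQ0 : lapComp γ φ ψ w 0 y = lapB γ u y := by
    rw [_root_.lapB_eq hud, lapComp, hu1 y hy, hu2]
    simp only [hA0, h.inv_zero, hB0, map_neg, sub_eq_add_neg]
  have hQ : HasDerivAt (fun t => lapComp γ φ ψ w t y) (innerVec γ u T X y) 0 := by
    have h1 := (HasDerivAt.fun_sum fun i (_ : i ∈ Finset.univ) =>
      HasDerivAt.fun_sum fun j (_ : j ∈ Finset.univ) =>
        (h.hasDerivAt_comp (contDiff_ginv hγ hpos i j) y).fun_smul
          ((hD2.clm_apply (h.hasDerivAt_fderiv y (stdVec i))).clm_apply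
            (h.hasDerivAt_fderiv y (stdVec j)))).fun_add
      (hD1.clm_apply (h.hasDerivAt_lapB hγ hpos y))
    refine h1.congr_deriv ?_
    simp only [hA0, hB0, h.inv_zero, hu1 y hy, hu2, innerVec, _root_.lapB_eq hTd, map_neg,
      add_apply, smul_add, Finset.sum_add_distrib, Finset.sum_sub_distrib,
      neg_smul, Finset.sum_neg_distrib]
    abel
  have hE := (h.hasDerivAt_jac hγ hpos y).fun_mul (hQ.inner ℝ hQ)
  refine hE.congr_deriv ?_
  have hdet : (fderiv ℝ (ψ 0) y).det = 1 := by
    rw [show ψ 0 = fun x => x from funext h.inv_zero, fderiv_fun_id]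
    simp [ContinuousLinearMap.det]
  rw [hQ0, hdet, h.inv_zero, innerDens, real_inner_self_eq_norm_sq,
    real_inner_comm (lapB γ u y)]
  ring

end IsFlow

end FirstVariation

section SphereProjection

open scoped ContDiff

variable {m n : ℕ}

theorem BddDiff.of_contDiffOn {E F : Type} [NormedAddCommGroup E] [NormedSpace ℝ E]
    [NormedAddCommGroup F] [NormedSpace ℝ F] {V K W : Set E} (hW : IsOpen W) (hK : IsCompact K)
    (hKW : K ⊆ W) (hVK : V ⊆ K) {k : ℕ} {f : E → F} (hf : ContDiffOn ℝ k f W) :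
    BddDiff V k f := by
  have base : ∀ {F : Type} [NormedAddCommGroup F] [NormedSpace ℝ F] {f : E → F},
      ContinuousOn f W → (∃ C, ∀ y ∈ V, ‖f y‖ ≤ C) ∧ ContinuousOn f V := by
    intro F _ _ f hf
    obtain ⟨C, hC⟩ := hK.exists_bound_of_continuousOn (hf.mono hKW)
    exact ⟨⟨C, fun y hy => hC y (hVK hy)⟩, hf.mono (hVK.trans hKW)⟩
  induction k generalizing F with
  | zero => exact base hf.continuousOn
  | succ k ih =>
    refine ⟨base hf.continuousOn, fun y hy => ?_, ih ?_⟩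
    · exact (hf.contDiffAt (hW.mem_nhds (hKW (hVK hy)))).differentiableAt (by simp)
    · exact hf.fderiv_of_isOpen hW (by simp)

/-- An open annulus containing the unit sphere. -/
def annulus (n : ℕ) : Set (Em n) := {p | 1 / 2 < ‖p‖ ∧ ‖p‖ < 2}

theorem isOpen_annulus : IsOpen (annulus n) :=
  (isOpen_lt continuous_const continuous_norm).inter (isOpen_lt continuous_norm continuous_const)

theorem bddDiff_sphProj (k : ℕ) : BddDiff (annulus n) k (sphProj (n := n)) := by
  refine BddDiff.of_contDiffOn (W := {0}ᶜ) (K := {p | 1 / 2 ≤ ‖p‖} ∩ Metric.closedBall 0 2)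
    isOpen_compl_singleton ?_ ?_ ?_ ?_
  · exact (isCompact_closedBall _ _).inter_left (isClosed_le continuous_const continuous_norm)
  · rintro p ⟨hp, -⟩ rfl
    norm_num at hp
  · exact fun p hp => ⟨hp.1.le, by simpa using hp.2.le⟩
  · have h : ContDiffOn ℝ k (fun p : Em n => ‖p‖) {0}ᶜ := fun p hp =>
      (contDiffAt_norm ℝ hp).contDiffWithinAt
    exact (h.inv fun p hp => norm_ne_zero_iff.2 hp).smul contDiffOn_id

theorem fderiv_sphProj {p : Em n} (hp : ‖p‖ = 1) (v : Em n) :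
    fderiv ℝ sphProj p v = v - ⟪v, p⟫ • p := by
  have hd : DifferentiableAt ℝ sphProj p := ((bddDiff_sphProj 1).2.1 p ⟨by rw [hp]; norm_num,
    by rw [hp]; norm_num⟩)
  have hc : HasDerivAt (fun t : ℝ => p + t • v) v 0 := by
    simpa using ((hasDerivAt_id (0 : ℝ)).smul_const v).const_add p
  have h1 : HasDerivAt (fun t : ℝ => sphProj (p + t • v)) (fderiv ℝ sphProj p v) 0 := by
    have := HasFDerivAt.comp_hasDerivAt (x := (0 : ℝ)) (f := fun t : ℝ => p + t • v)
      (l := sphProj) (l' := fderiv ℝ sphProj p) (by simpa using hd.hasFDerivAt) hc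
    exact this
  have h2 : HasDerivAt (fun t : ℝ => sphProj (p + t • v)) (v - ⟪v, p⟫ • p) 0 := by
    have hn := (hc.norm_sq.sqrt (by simp [hp])).inv (by simp [hp])
    have h3 := hn.smul hc
    refine (h3.congr_deriv ?_).congr_of_eventuallyEq (Filter.Eventually.of_forall fun t => ?_)
    · simp [hp, real_inner_comm v p, sub_eq_add_neg]
    · simp [sphProj]
  exact h1.unique h2

end SphereProjection

section InnerVariation

open scoped ContDiff

variable {m n : ℕ} {R : ℝ} {γ : Em m → Matrix (Fin m) (Fin m) ℝ} {g u : Em m → Em n}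

theorem setIntegral_muG (hm : 0 < m) (hγ : ∀ i j, ContDiff ℝ ∞ (fun y => γ y i j))
    (hpos : ∀ x, (γ x).PosDef) (f : Em m → ℝ) :
    ∫ x in halfBall m R, f x ∂muG γ = ∫ x in openHalfBall m R, sqg γ x * f x := by
  have hs : Measurable (sqg γ) := (contDiff_sqg hγ hpos).continuous.measurable
  have hae : (halfBall m R : Set (Em m)) =ᵐ[muG γ] openHalfBall m R :=
    (withDensity_absolutelyContinuous _ _).ae_le (halfBall_ae_eq hm)
  rw [setIntegral_congr_set hae, muG, setIntegral_withDensity_eq_setIntegral_toReal_smul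
    hs.ennreal_ofReal (Filter.Eventually.of_forall fun _ => ENNReal.ofReal_lt_top) _
    (isOpen_openHalfBall R).measurableSet]
  simp [ENNReal.toReal_ofReal (sqg_pos hpos _).le]

/-- The variation of the map `u` induced by the vector field `X` through the boundary data. -/
def tanVar (g u : Em m → Em n) (X : Em m → Em m) (y : Em m) : Em n :=
  -(fderiv ℝ g y (X y) - ⟪fderiv ℝ g y (X y), u y⟫ • u y)

theorem exists_isFlow_tangential (hm : 0 < m) (hR : 0 < R) {ξ : Em m → Em m}
    (hξ : ContDiff ℝ ∞ ξ) (hc : HasCompactSupport ξ)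
    (h₁ : ∀ x, lastCLM m x = 0 → lastCLM m (ξ x) = 0) (h₂ : ∀ x, ‖x‖ = R → ⟪ξ x, x⟫ = 0) :
    ∃ φ ψ : ℝ → Em m → Em m, IsFlow φ ψ ξ ∧
      (∀ t x, φ t x ∈ openHalfBall m R ↔ x ∈ openHalfBall m R) ∧
      (∀ t x, φ t x ∈ closedHalfBall m R ↔ x ∈ closedHalfBall m R) := by
  obtain ⟨δ, hδ, φ, ψ, h1, h2, h3, h4, h5, h6, h7, h8⟩ := exists_tangential_family hm hR hξ hc h₁ h₂
  have hs : ContDiff ℝ ∞ (fun z : ℝ × Em m => (δ⁻¹ * z.1, z.2)) := by fun_prop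
  refine ⟨fun t => φ (δ⁻¹ * t), fun t => ψ (δ⁻¹ * t), ⟨h1.comp hs, h2.comp hs, fun t => h3 _,
    fun t => h4 _, by simpa using h5, fun x => ?_, hξ⟩, fun t => h7 _, fun t => h8 _⟩
  have hd : HasDerivAt (fun t : ℝ => δ⁻¹ * t) δ⁻¹ 0 := by
    simpa using (hasDerivAt_id (0 : ℝ)).const_mul δ⁻¹
  have := HasDerivAt.scomp (0 : ℝ) (g₁ := fun t => φ t x) (h := fun t : ℝ => δ⁻¹ * t)
    (by simpa using h6 x) hd
  rw [smul_smul, inv_mul_cancel₀ hδ.ne', one_smul] at this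
  exact this

theorem exists_diffFamily_variation (hm : 0 < m) (hR : 0 < R)
    (hg : ContDiffOn ℝ 3 g (closedHalfBall m R)) (hu : ContDiffOn ℝ 2 u (closedHalfBall m R))
    (huS : ∀ x ∈ closedHalfBall m R, ‖u x‖ = 1) {φ ψ : ℝ → Em m → Em m} {X : Em m → Em m}
    (h : IsFlow φ ψ X) (hφ : ∀ t x, φ t x ∈ closedHalfBall m R ↔ x ∈ closedHalfBall m R) :
    ∃ ε > 0, ∃ w', DiffFamily (Set.Ioo (-ε) ε) (openHalfBall m R) 2
      (fun t z => sphProj (u z - g z + g (ψ t z))) w' ∧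
      ∀ y ∈ openHalfBall m R, w' 0 y = tanVar g u X y := by
  have hK := isCompact_closedHalfBall (m := m) R
  have hKu := uniqueDiffOn_closedHalfBall (m := m) hm hR
  have hU := isOpen_openHalfBall (m := m) R
  have hint := interior_closedHalfBall (m := m) hm hR
  have hψK : ∀ t x, x ∈ closedHalfBall m R → ψ t x ∈ closedHalfBall m R := fun t x hx => by
    rwa [← hφ t, h.right_inv]
  have hgψ : ∀ ε > 0, ∃ g', DiffFamily (Set.Ioo (-ε) ε) (openHalfBall m R) 2
      (fun t z => g (ψ t z)) g' := fun ε hε => by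
    rw [← hint]
    refine ⟨_, diffFamily_of_contDiffOn (k := 2) (f := fun t z => g (ψ t z)) hK hKu
      (by linarith) ?_⟩
    refine ContDiffOn.comp (g := g) (f := fun z : ℝ × Em m => ψ z.1 z.2) (by norm_num; exact hg)
      (h.smooth_inv.of_le (WithTop.coe_le_coe.2 le_top)).contDiffOn fun z hz => hψK _ _ hz.2
  obtain ⟨ε, hε, hmem⟩ : ∃ ε > 0, ∀ t ∈ Set.Ioo (-ε) ε, ∀ y ∈ openHalfBall m R,
      u y - g y + g (ψ t y) ∈ annulus n := by
    obtain ⟨g', hg'⟩ := hgψ 1 one_pos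
    obtain ⟨C, hC⟩ := hg'.base.bdd'
    refine ⟨1 / (2 * (|C| + 1)), by positivity, fun t ht y hy => ?_⟩
    have hlt : |t| < 1 / (2 * (|C| + 1)) := abs_lt.2 ht
    have hle : 1 / (2 * (|C| + 1)) ≤ 1 / 2 := by
      apply one_div_le_one_div_of_le <;> linarith [abs_nonneg C]
    have ht1 : t ∈ Set.Ioo (-1 : ℝ) 1 := abs_lt.1 (by linarith)
    have hd := (convex_Ioo (-1 : ℝ) 1).norm_image_sub_le_of_norm_hasDerivWithin_le
      (f := fun s => g (ψ s y)) (C := |C|)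
      (fun s hs => (hg'.base.deriv s hs y hy).hasDerivWithinAt)
      (fun s hs => (hC s hs y hy).trans (le_abs_self C)) (x := 0) (by simp) ht1
    simp only [h.inv_zero, sub_zero, Real.norm_eq_abs] at hd
    have hd2 : ‖g (ψ t y) - g y‖ < 1 / 2 := by
      refine hd.trans_lt ?_
      rw [lt_div_iff₀ (by positivity)] at hlt
      nlinarith [abs_nonneg C, abs_nonneg t]
    have hy1 := huS y (openHalfBall_subset hy)
    rw [show u y - g y + g (ψ t y) = u y + (g (ψ t y) - g y) by abel]
    constructor
    · have := norm_sub_le_norm_add (u y) (g (ψ t y) - g y)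
      linarith
    · have := norm_add_le (u y) (g (ψ t y) - g y)
      linarith
  have hI : IsOpen (Set.Ioo (-ε) ε) := isOpen_Ioo
  have h0 : (0 : ℝ) ∈ Set.Ioo (-ε) ε := by simpa using hε
  obtain ⟨g', hg'⟩ := hgψ ε hε
  have hug : BddDiff (openHalfBall m R) 2 (fun z => u z - g z) :=
    hint ▸ ContDiffOn.bddDiff hK hKu (hu.sub (hg.of_le (by norm_num)))
  have hp := (hug.diffFamily hI hU).add hI hU hg'
  refine ⟨ε, hε, _, DiffFamily.comp hI hU isOpen_annulus (bddDiff_sphProj 3) hp hmem, fun y hy => ?_⟩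
  have hgd : DifferentiableAt ℝ g y :=
    (hg.contDiffAt (Filter.mem_of_superset (hU.mem_nhds hy) openHalfBall_subset)).differentiableAt
      (by simp)
  have hgy : g' 0 y = -fderiv ℝ g y (X y) := by
    refine (hg'.base.deriv 0 h0 y hy).unique ?_
    have := HasFDerivAt.comp_hasDerivAt (x := (0 : ℝ)) (f := fun t : ℝ => ψ t y)
      (l := g) (l' := fderiv ℝ g y) (by simpa [h.inv_zero] using hgd.hasFDerivAt) (h.deriv_inv y)
    rw [map_neg] at this
    exact this
  have hu0 : u y - g y + g (ψ 0 y) = u y := by rw [h.inv_zero]; abel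
  simp only [hu0, hgy, zero_add]
  rw [fderiv_sphProj (huS y (openHalfBall_subset hy)), tanVar, inner_neg_left, neg_smul]
  abel

end InnerVariation

section InnerVariation

open scoped ContDiff

variable {m n : ℕ} {R : ℝ} {γ : Em m → Matrix (Fin m) (Fin m) ℝ} {g u : Em m → Em n}

theorem volume_openHalfBall_lt_top : volume (openHalfBall m R) < ⊤ :=
  ((measure_mono fun _ hx => by simpa using hx.1.le).trans_lt
    (isCompact_closedBall (0 : Em m) R).measure_lt_top)

/-- The first variation formula for globally defined tangential vector fields. -/
theorem setIntegral_innerDens_eq_zero (hm : 0 < m) (hR : 0 < R)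
    (hγ : ∀ i j, ContDiff ℝ ∞ (fun y => γ y i j)) (hpos : ∀ x, (γ x).PosDef)
    (hg : ContDiffOn ℝ 3 g (closedHalfBall m R)) (hu : ContDiffOn ℝ 2 u (closedHalfBall m R))
    (huS : ∀ x ∈ closedHalfBall m R, ‖u x‖ = 1) (hvb : VarBiharmonic m n R γ g u)
    {X : Em m → Em m} (hX : ContDiff ℝ ∞ X) (hc : HasCompactSupport X)
    (h₁ : ∀ x, lastCLM m x = 0 → lastCLM m (X x) = 0) (h₂ : ∀ x, ‖x‖ = R → ⟪X x, x⟫ = 0) :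
    ∫ y in openHalfBall m R, innerDens γ u (tanVar g u X) X y = 0 := by
  have hU := isOpen_openHalfBall (m := m) R
  obtain ⟨φ, ψ, h, hφo, hφc⟩ := exists_isFlow_tangential hm hR hX hc h₁ h₂
  obtain ⟨ε, hε, w', hw, hw0⟩ := exists_diffFamily_variation hm hR hg hu huS h hφc
  have hint := interior_closedHalfBall (m := m) hm hR
  have h0 : (0 : ℝ) ∈ Set.Ioo (-ε) ε := by simpa using hε
  obtain ⟨H, hH⟩ := h.exists_bddDiffFamily_energyDens hγ hpos (isCompact_closedHalfBall R)
    (uniqueDiffOn_closedHalfBall hm hR) (by linarith) (hint.symm ▸ hw)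
  rw [hint] at hH
  have hD := (hH.hasDerivAt_integral hU volume_openHalfBall_lt_top isOpen_Ioo h0).2
  have hfr : frontier (halfBall m R) = closedHalfBall m R \ openHalfBall m R := by
    rw [frontier, closure_halfBall hm hR, interior_halfBall hm]
  have hE := hvb.2 φ h.smooth h.zero
    (fun t _ => by
      rw [closure_halfBall hm hR]
      exact ⟨fun x hx => (hφc t x).2 hx, fun x _ y _ hxy => by
        rw [← h.left_inv t x, hxy, h.left_inv], fun x hx => ⟨ψ t x, (hφc t _).1 (by
        rwa [h.right_inv]), h.right_inv t x⟩⟩)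
    (fun t _ => by
      rw [hfr]
      exact fun x hx => ⟨(hφc t x).2 hx.1, fun hx' => hx.2 ((hφo t x).1 hx')⟩)
  have hEq : (fun t : ℝ => ∫ x in halfBall m R,
      ‖lapB γ (fun y => sphProj (u (φ t y) - g (φ t y) + g y)) x‖ ^ 2 ∂muG γ) =ᶠ[nhds 0]
      fun t => ∫ y in openHalfBall m R, IsFlow.energyDens γ φ ψ
        (fun t z => sphProj (u z - g z + g (ψ t z))) t y := by
    filter_upwards [isOpen_Ioo.mem_nhds h0] with t ht
    rw [setIntegral_muG hm hγ hpos, ← h.setIntegral_lapB hU hφo hw ht]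
    simp only [h.left_inv]
  refine Eq.trans ?_ ((hE.congr_of_eventuallyEq hEq.symm).unique hD).symm
  refine setIntegral_congr_fun hU.measurableSet fun y hy => ?_
  refine (h.hasDerivAt_energyDens hγ hpos hU h0 hw (fun z hz => ?_) hw0 hy).unique
    (hH.deriv 0 h0 y hy)
  rw [h.inv_zero, sub_add_cancel, sphProj, huS z (openHalfBall_subset hz)]
  simp

end InnerVariation

section Approximation

open scoped ContDiff Manifold

variable {m : ℕ} {R : ℝ}

theorem exists_contDiff_eqOn {F : Type} [NormedAddCommGroup F] [NormedSpace ℝ F]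
    {K W : Set (Em m)} (hK : IsClosed K) (hW : IsOpen W) (hKW : K ⊆ W) {f : Em m → F}
    (hf : ContDiffOn ℝ ∞ f W) : ∃ f', ContDiff ℝ ∞ f' ∧ ∀ x ∈ K, f' x = f x := by
  obtain ⟨η, h0, h1, -⟩ := exists_contMDiffMap_zero_one_nhds_of_isClosed (n := ⊤) 𝓘(ℝ, Em m)
    hW.isClosed_compl hK (Set.disjoint_compl_left_iff_subset.2 hKW)
  have hη : ContDiff ℝ ∞ η := η.contMDiff.contDiff
  refine ⟨fun x => η x • f x, contDiff_iff_contDiffAt.2 fun x => ?_, fun x hx => ?_⟩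
  · by_cases hx : x ∈ W
    · exact hη.contDiffAt.smul (hf.contDiffAt (hW.mem_nhds hx))
    · have h2 : (fun y => η y • f y) =ᶠ[nhds x] fun _ => 0 := by
        filter_upwards [(Filter.eventually_of_mem (Filter.mem_of_superset h0 fun _ h => h)
          fun _ h => h).filter_mono (nhds_le_nhdsSet (s := Wᶜ) hx)] with y hy
        rw [hy, zero_smul]
      exact contDiffAt_const.congr_of_eventuallyEq h2
  · simp [h1.self_of_nhdsSet x hx]

/-- The orthogonal projection to the hyperplane `{xᵐ = 0}`. -/
def flatProj (x : Em m) : Em m := x - lastCLM m x • lastVec m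

theorem contDiff_flatProj : ContDiff ℝ ∞ (flatProj (m := m)) := by
  unfold flatProj
  fun_prop

theorem lastCLM_flatProj (hm : 0 < m) (x : Em m) : lastCLM m (flatProj x) = 0 := by
  simp [flatProj, lastCLM_lastVec hm]

theorem flatProj_eq_self {x : Em m} (hx : lastCLM m x = 0) : flatProj x = x := by
  simp [flatProj, hx]

theorem norm_flatProj_le (hm : 0 < m) (x : Em m) : ‖flatProj x‖ ≤ ‖x‖ := by
  have h : ‖flatProj x‖ ^ 2 ≤ ‖x‖ ^ 2 := by
    rw [flatProj, norm_sub_sq_real, norm_smul, norm_lastVec hm, real_inner_smul_right,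
      real_inner_comm, inner_lastVec, Real.norm_eq_abs, mul_one, sq_abs]
    nlinarith [sq_nonneg (lastCLM m x)]
  exact (sq_le_sq₀ (norm_nonneg _) (norm_nonneg _)).1 h

theorem flatProj_mem (hm : 0 < m) {x : Em m} (hx : ‖x‖ ≤ R) : flatProj x ∈ closedHalfBall m R :=
  ⟨(norm_flatProj_le hm x).trans hx, (lastCLM_flatProj hm x).ge⟩

/-- A smooth map into the closed ball that is the radial retraction away from the origin, with a
cutoff function. -/
theorem exists_radial_retraction (hR : 0 < R) : ∃ (ρ : Em m → Em m) (χ : Em m → ℝ),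
    ContDiff ℝ ∞ ρ ∧ ContDiff ℝ ∞ χ ∧ (∀ x, ∃ a : ℝ, 0 ≤ a ∧ ρ x = a • x) ∧ (∀ x, ‖ρ x‖ ≤ R) ∧
    (∀ x, χ x ≠ 0 → ‖ρ x‖ = R) ∧ ∀ x, ‖x‖ = R → ρ x = x ∧ χ x = (R ^ 2)⁻¹ := by
  let b : ContDiffBump (0 : Em m) := ⟨R / 4, R / 2, by positivity, by linarith⟩
  let c : ContDiffBump (0 : Em m) := ⟨R / 2, 3 * R / 4, by positivity, by linarith⟩
  have hb : ∀ x : Em m, R / 2 ≤ ‖x‖ → b x = 0 := fun x hx => b.zero_of_le_dist (by simpa using hx)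
  have hpos : ∀ x : Em m, 0 < ‖x‖ ^ 2 + b x * R ^ 2 := fun x => by
    rcases lt_or_ge ‖x‖ (R / 2) with h | h
    · have : 0 < b x := b.pos_of_mem_ball (by simpa using h)
      positivity
    · have := hb x h
      have : 0 < ‖x‖ := by linarith
      rw [hb x h]
      positivity
  have hs : ContDiff ℝ ∞ fun x : Em m => ‖x‖ ^ 2 + b x * R ^ 2 :=
    (contDiff_id.norm_sq ℝ).add (b.contDiff.mul contDiff_const)
  have hfar : ∀ x : Em m, R / 2 ≤ ‖x‖ → (√(‖x‖ ^ 2 + b x * R ^ 2))⁻¹ = ‖x‖⁻¹ := fun x hx => by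
    rw [hb x hx, zero_mul, add_zero, Real.sqrt_sq (norm_nonneg x)]
  refine ⟨fun x => (R * (√(‖x‖ ^ 2 + b x * R ^ 2))⁻¹) • x, fun x => (1 - c x) * (R ^ 2)⁻¹,
    ?_, ?_, fun x => ⟨R * (√(‖x‖ ^ 2 + b x * R ^ 2))⁻¹, ?_, rfl⟩, fun x => ?_, fun x hx => ?_, fun x hx => ⟨?_, ?_⟩⟩
  · exact (contDiff_const.mul ((hs.sqrt fun x => (hpos x).ne').inv
      fun x => (Real.sqrt_pos.2 (hpos x)).ne')).smul contDiff_id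
  · exact (contDiff_const.sub c.contDiff).mul contDiff_const
  · positivity
  · rw [norm_smul, Real.norm_of_nonneg (by positivity), mul_assoc, ← div_eq_inv_mul]
    refine mul_le_of_le_one_right hR.le ((div_le_one (Real.sqrt_pos.2 (hpos x))).2 ?_)
    refine Real.le_sqrt_of_sq_le ?_
    have := b.nonneg' x
    have : 0 ≤ b x * R ^ 2 := by positivity
    linarith
  · have h : R / 2 ≤ ‖x‖ := by
      by_contra! h
      exact hx (by simp [c.one_of_mem_closedBall (x := x) (by simpa using h.le)])
    have : 0 < ‖x‖ := by linarith
    simp only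
    rw [norm_smul, hfar x h, Real.norm_of_nonneg (by positivity)]
    field_simp
  · simp only
    rw [hfar x (by linarith), hx, mul_inv_cancel₀ hR.ne', one_smul]
  · simp only
    rw [c.zero_of_le_dist (by simp [c]; linarith)]
    simp

/-- A correction of the value `z₀` of a vector field at `x`, from its values at three boundary
points. -/
def tangCorr (x y : Em m) (c : ℝ) (z₀ z₁ z₂ z₃ : Em m) : Em m :=
  z₀ - lastCLM m z₁ • lastVec m - (c * ⟪z₂ - lastCLM m z₃ • lastVec m, y⟫) • x

theorem contDiffOn_tangCorr {E : Type} [NormedAddCommGroup E] [NormedSpace ℝ E] {S : Set E}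
    {x y z₀ z₁ z₂ z₃ : E → Em m} {c : E → ℝ} (hx : ContDiffOn ℝ ∞ x S) (hy : ContDiffOn ℝ ∞ y S)
    (hc : ContDiffOn ℝ ∞ c S) (h₀ : ContDiffOn ℝ ∞ z₀ S) (h₁ : ContDiffOn ℝ ∞ z₁ S)
    (h₂ : ContDiffOn ℝ ∞ z₂ S) (h₃ : ContDiffOn ℝ ∞ z₃ S) :
    ContDiffOn ℝ ∞ (fun e => tangCorr (x e) (y e) (c e) (z₀ e) (z₁ e) (z₂ e) (z₃ e)) S := by
  have hl : ∀ {z : E → Em m}, ContDiffOn ℝ ∞ z S →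
      ContDiffOn ℝ ∞ (fun e => lastCLM m (z e) • lastVec m) S := fun hz =>
    ((lastCLM m).contDiff.comp_contDiffOn hz).smul contDiffOn_const
  exact (h₀.sub (hl h₁)).sub ((hc.mul ((h₂.sub (hl h₃)).inner ℝ hy)).smul hx)

end Approximation

section Approximation

open scoped ContDiff

variable {m : ℕ} {R : ℝ}

theorem lastCLM_tangCorr_eq_zero (hm : 0 < m) {x : Em m} (hx : lastCLM m x = 0) (y z z₂ z₃ : Em m)
    (c : ℝ) : lastCLM m (tangCorr x y c z z z₂ z₃) = 0 := by
  simp [tangCorr, lastCLM_lastVec hm, hx]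

theorem inner_tangCorr_eq_zero (hR : 0 < R) {x : Em m} (hx : ‖x‖ = R) (z w : Em m) :
    ⟪tangCorr x x (R ^ 2)⁻¹ z w z w, x⟫ = 0 := by
  rw [tangCorr, inner_sub_left, real_inner_smul_left, real_inner_self_eq_norm_sq, hx]
  field_simp
  ring

/-- The correction of a vector field `Z` that makes it tangential. -/
def tangExt (ρ : Em m → Em m) (χ : Em m → ℝ) (Z : Em m → Em m) (x : Em m) : Em m :=
  tangCorr x (ρ x) (χ x) (Z x) (Z (flatProj x)) (Z (ρ x)) (Z (flatProj (ρ x)))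

/-- The homothety with ratio `1 - s ^ 2` about a point of the half-ball. -/
def homothety (R s : ℝ) (x : Em m) : Em m :=
  (R / 2) • lastVec m + (1 - s ^ 2) • (x - (R / 2) • lastVec m)

theorem homothety_zero (x : Em m) : homothety R 0 x = x := by simp [homothety]

theorem contDiff_homothety : ContDiff ℝ ∞ (fun z : ℝ × Em m => homothety R z.1 z.2) := by
  unfold homothety
  fun_prop

theorem homothety_mem (hm : 0 < m) (hR : 0 < R) {s : ℝ} (hs : s ∈ Set.Icc (-(1 / 2)) (1 / 2))
    {x : Em m} (hx : x ∈ closedHalfBall m R) : homothety R s x ∈ closedHalfBall m R := by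
  have hs1 : s ^ 2 ≤ 1 := by nlinarith [hs.1, hs.2]
  exact (convex_closedHalfBall R).add_smul_sub_mem (openHalfBall_subset (halfLastVec_mem hm hR)) hx
    ⟨by linarith, by nlinarith⟩

theorem homothety_mem_interior (hm : 0 < m) (hR : 0 < R) {s : ℝ}
    (hs : s ∈ Set.Icc (-(1 / 2)) (1 / 2)) (h0 : s ≠ 0) {x : Em m} (hx : x ∈ closedHalfBall m R) :
    homothety R s x ∈ interior (closedHalfBall m R) := by
  have hs1 : s ^ 2 ≤ 1 := by nlinarith [hs.1, hs.2]
  have := (convex_closedHalfBall R).add_smul_sub_mem_interior hx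
    ((interior_closedHalfBall hm hR).symm ▸ halfLastVec_mem hm hR) (t := s ^ 2)
    ⟨by positivity, hs1⟩
  convert this using 1
  rw [homothety]
  module

theorem contDiffOn_tangExt_homothety (hm : 0 < m) (hR : 0 < R) {ρ X : Em m → Em m}
    {χ : Em m → ℝ} (hρ : ContDiff ℝ ∞ ρ) (hχ : ContDiff ℝ ∞ χ)
    (hρK : ∀ x ∈ closedHalfBall m R, ρ x ∈ closedHalfBall m R)
    (hX : ContDiffOn ℝ ∞ X (closedHalfBall m R)) :
    ContDiffOn ℝ ∞ (fun z : ℝ × Em m => tangExt ρ χ (fun x => X (homothety R z.1 x)) z.2)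
      (Set.Icc (-(1 / 2)) (1 / 2) ×ˢ closedHalfBall m R) := by
  have hc : ∀ {f : Em m → Em m}, ContDiff ℝ ∞ f →
      (∀ x ∈ closedHalfBall m R, f x ∈ closedHalfBall m R) →
      ContDiffOn ℝ ∞ (fun z : ℝ × Em m => X (homothety R z.1 (f z.2)))
        (Set.Icc (-(1 / 2)) (1 / 2) ×ˢ closedHalfBall m R) := fun {f} hf hfK => by
    have h1 : ContDiff ℝ ∞ (fun z : ℝ × Em m => homothety R z.1 (f z.2)) :=
      ContDiff.comp (g := fun z : ℝ × Em m => homothety R z.1 z.2)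
        (f := fun z : ℝ × Em m => (z.1, f z.2)) contDiff_homothety
        (contDiff_fst.prodMk (hf.comp contDiff_snd))
    exact ContDiffOn.comp (g := X) (f := fun z : ℝ × Em m => homothety R z.1 (f z.2)) hX
      h1.contDiffOn fun z hz => homothety_mem hm hR hz.1 (hfK _ hz.2)
  have hP : ∀ x ∈ closedHalfBall m R, flatProj x ∈ closedHalfBall m R :=
    fun x hx => flatProj_mem hm hx.1
  exact contDiffOn_tangCorr contDiffOn_snd (hρ.comp contDiff_snd).contDiffOn
    (hχ.comp contDiff_snd).contDiffOn (hc (f := fun x => x) contDiff_id fun _ h => h)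
    (hc contDiff_flatProj hP) (hc hρ hρK)
    (hc (f := fun x => flatProj (ρ x)) (contDiff_flatProj.comp hρ) fun x hx => hP _ (hρK x hx))

/-- A vector field on the half-ball that is tangential to the boundary is a limit of restrictions
of smooth compactly supported ones that are tangential to the hyperplane and the sphere. -/
theorem exists_tangential_approx (hm : 0 < m) (hR : 0 < R) {X : Em m → Em m}
    (hX : ContDiffOn ℝ ∞ X (closedHalfBall m R))
    (h₁ : ∀ x, ‖x‖ ≤ R → lastCLM m x = 0 → lastCLM m (X x) = 0)
    (h₂ : ∀ x, ‖x‖ = R → 0 ≤ lastCLM m x → ⟪X x, x⟫ = 0) :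
    ∃ F : ℝ → Em m → Em m,
      ContDiffOn ℝ ∞ (fun z : ℝ × Em m => F z.1 z.2)
        (Set.Icc (-(1 / 2)) (1 / 2) ×ˢ closedHalfBall m R) ∧
      (∀ x ∈ closedHalfBall m R, F 0 x = X x) ∧
      ∀ s ∈ Set.Icc (-(1 / 2) : ℝ) (1 / 2), s ≠ 0 → ∃ Y : Em m → Em m, ContDiff ℝ ∞ Y ∧
        HasCompactSupport Y ∧ (∀ x, lastCLM m x = 0 → lastCLM m (Y x) = 0) ∧
        (∀ x, ‖x‖ = R → ⟪Y x, x⟫ = 0) ∧ ∀ x ∈ closedHalfBall m R, Y x = F s x := by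
  obtain ⟨ρ, χ, hρ, hχ, hρx, hρR, hχρ, hρS⟩ := exists_radial_retraction (m := m) hR
  have hρK : ∀ x ∈ closedHalfBall m R, ρ x ∈ closedHalfBall m R := fun x hx => by
    obtain ⟨a, ha, hax⟩ := hρx x
    refine ⟨hρR x, ?_⟩
    rw [hax, map_smul]
    exact mul_nonneg ha hx.2
  have hP : ∀ x ∈ closedHalfBall m R, flatProj x ∈ closedHalfBall m R :=
    fun x hx => flatProj_mem hm hx.1
  refine ⟨fun s => tangExt ρ χ fun x => X (homothety R s x),
    contDiffOn_tangExt_homothety hm hR hρ hχ hρK hX, fun x hx => ?_, fun s hs h0 => ?_⟩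
  · have hflat : ∀ y ∈ closedHalfBall m R, lastCLM m (X (flatProj y)) = 0 := fun y hy =>
      h₁ _ (hP y hy).1 (lastCLM_flatProj hm y)
    simp only [tangExt, homothety_zero, tangCorr, hflat x hx, hflat _ (hρK x hx), zero_smul,
      sub_zero]
    by_cases hχx : χ x = 0
    · simp [hχx]
    · rw [h₂ _ (hχρ x hχx) (hρK x hx).2]
      simp
  · have hcont : ContDiff ℝ ∞ (homothety R s : Em m → Em m) :=
      ContDiff.comp (g := fun z : ℝ × Em m => homothety R z.1 z.2) (f := fun x : Em m => (s, x))
        contDiff_homothety (contDiff_prodMk_right s)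
    have hXs : ContDiffOn ℝ ∞ (fun x => X (homothety R s x))
        (homothety R s ⁻¹' interior (closedHalfBall m R)) :=
      ContDiffOn.comp (g := X) (f := homothety R s) hX hcont.contDiffOn
        fun x hx => interior_subset hx
    obtain ⟨Z, hZ, hZK⟩ := exists_contDiff_eqOn (f := fun x => X (homothety R s x))
      (isClosed_closedHalfBall (m := m) R)
      (isOpen_interior.preimage hcont.continuous) (fun x => homothety_mem_interior hm hR hs h0)
      hXs
    let b : ContDiffBump (0 : Em m) := ⟨R, 2 * R, hR, by linarith⟩
    have hTZ : ContDiff ℝ ∞ (tangExt ρ χ Z) := contDiffOn_univ.1 (contDiffOn_tangCorr contDiffOn_id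
      hρ.contDiffOn hχ.contDiffOn hZ.contDiffOn (hZ.comp contDiff_flatProj).contDiffOn
      (hZ.comp hρ).contDiffOn (hZ.comp (contDiff_flatProj.comp hρ)).contDiffOn)
    refine ⟨fun x => b x • tangExt ρ χ Z x, b.contDiff.smul hTZ, b.hasCompactSupport.smul_right,
      fun x hx => ?_, fun x hx => ?_, fun x hx => ?_⟩
    · simp only [tangExt, map_smul, flatProj_eq_self hx, lastCLM_tangCorr_eq_zero hm hx, smul_zero]
    · simp only [tangExt, (hρS x hx).1, (hρS x hx).2, real_inner_smul_left,
        inner_tangCorr_eq_zero hR hx, mul_zero]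
    · simp only [tangExt, b.one_of_mem_closedBall (x := x) (by simpa [b] using hx.1), one_smul]
      rw [hZK x hx, hZK _ (hP x hx), hZK _ (hρK x hx), hZK _ (hP _ (hρK x hx))]

end Approximation

section InnerVariation

open scoped ContDiff

variable {m n : ℕ} {R : ℝ} {γ : Em m → Matrix (Fin m) (Fin m) ℝ} {g u : Em m → Em n}
  {I : Set ℝ} {U K : Set (Em m)}

theorem BddCurve.of_bddDiff {F : Type} [NormedAddCommGroup F] [NormedSpace ℝ F] (hI : IsOpen I)
    (hU : IsOpen U) {k : ℕ} {f : Em m → F} (hf : BddDiff U k f) : BddCurve I U (fun _ y => f y) :=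
  ⟨_, (hf.diffFamily hI hU).base⟩

theorem BddCurve.congr {F : Type} [NormedAddCommGroup F] [NormedSpace ℝ F] (hI : IsOpen I)
    {p q : ℝ → Em m → F} (hp : BddCurve I U p) (h : ∀ t ∈ I, ∀ y ∈ U, p t y = q t y) :
    BddCurve I U q :=
  let ⟨_, hp⟩ := hp
  ⟨_, hp.congr hI h fun _ _ _ _ => rfl⟩

theorem BddDiff.of_contDiff {F : Type} [NormedAddCommGroup F] [NormedSpace ℝ F]
    (hK : IsCompact K) (hKu : UniqueDiffOn ℝ K) (k : ℕ) {f : Em m → F} (hf : ContDiff ℝ ∞ f) :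
    BddDiff (interior K) k f :=
  ContDiffOn.bddDiff hK hKu (hf.of_le (WithTop.coe_le_coe.2 le_top)).contDiffOn

theorem DiffFamily.bddCurve_lapB (hγ : ∀ i j, ContDiff ℝ ∞ (fun y => γ y i j))
    (hpos : ∀ x, (γ x).PosDef) (hI : IsOpen I) (hK : IsCompact K) (hKu : UniqueDiffOn ℝ K)
    {p p' : ℝ → Em m → Em n} (hp : DiffFamily I (interior K) 2 p p') :
    BddCurve I (interior K) (fun t y => lapB γ (p t) y) := by
  have hU : IsOpen (interior K) := isOpen_interior
  have hc : ∀ {F : Type} [NormedAddCommGroup F] [NormedSpace ℝ F] {f : Em m → F},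
      ContDiff ℝ ∞ f → BddCurve I (interior K) (fun _ y => f y) := fun hf =>
    BddCurve.of_bddDiff hI hU (BddDiff.of_contDiff hK hKu 0 hf)
  have hD1 : BddCurve I (interior K) (fun t y => fderiv ℝ (p t) y) := ⟨_, hp.2.2.base⟩
  have hD2 : BddCurve I (interior K) (fun t y => fderiv ℝ (fderiv ℝ (p t)) y) := ⟨_, hp.2.2.2.2⟩
  have h1 : BddCurve I (interior K) (fun t y =>
      (∑ i, ∑ j, ginv γ y i j • fderiv ℝ (fderiv ℝ (p t)) y (stdVec i) (stdVec j))
        + fderiv ℝ (p t) y (-chrVec γ y)) :=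
    BddCurve.add hI hU (BddCurve.sum hI hU fun i => BddCurve.sum hI hU fun j =>
      (hc (contDiff_ginv hγ hpos i j)).smul ((hD2.clm_apply (hc contDiff_const)).clm_apply
        (hc contDiff_const))) (hD1.clm_apply (hc (contDiff_chrVec hγ hpos).neg))
  refine h1.congr hI fun t ht y hy => ?_
  rw [lapB_eq (hp.2.2.2.1 t ht y hy).1, map_neg, sub_eq_add_neg]

theorem DiffFamily.exists_diffFamily_tanVar {F F' : ℝ → Em m → Em m} (hI : IsOpen I) (hU : IsOpen U)
    (hg : BddDiff U 3 g) (hu : BddDiff U 2 u) (hF : DiffFamily I U 2 F F') :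
    ∃ T', DiffFamily I U 2 (fun t => tanVar g u (F t)) T' := by
  have hu' := hu.diffFamily (I := I) hI hU
  have h1 := (hg.2.2.diffFamily (I := I) hI hU).bilin hI hU (ContinuousLinearMap.id ℝ _) hF
  have h2 := (h1.bilin hI hU (innerSL ℝ) hu').bilin hI hU (ContinuousLinearMap.lsmul ℝ ℝ) hu'
  have h3 := (h1.add hI hU (h2.clm hI hU (-ContinuousLinearMap.id ℝ _))).clm hI hU
    (-ContinuousLinearMap.id ℝ _)
  exact ⟨_, h3.congr hI hU (fun t _ y _ => by
      simp only [tanVar, neg_apply, ContinuousLinearMap.id_apply,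
        sub_eq_add_neg]
      rfl)
    fun _ _ _ _ => rfl⟩

theorem BddCurve.innerDens (hγ : ∀ i j, ContDiff ℝ ∞ (fun y => γ y i j))
    (hpos : ∀ x, (γ x).PosDef) (hI : IsOpen I) (hK : IsCompact K) (hKu : UniqueDiffOn ℝ K)
    (hu : BddDiff (interior K) 2 u) {T T' : ℝ → Em m → Em n} {F F' : ℝ → Em m → Em m}
    (hT : DiffFamily I (interior K) 2 T T') (hF : DiffFamily I (interior K) 2 F F') :
    BddCurve I (interior K) (fun t y => innerDens γ u (T t) (F t) y) := by
  have hU : IsOpen (interior K) := isOpen_interior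
  have hc : ∀ {F : Type} [NormedAddCommGroup F] [NormedSpace ℝ F] {f : Em m → F},
      ContDiff ℝ ∞ f → BddCurve I (interior K) (fun _ y => f y) := fun hf =>
    BddCurve.of_bddDiff hI hU (BddDiff.of_contDiff hK hKu 0 hf)
  have hc' : ∀ {F : Type} [NormedAddCommGroup F] [NormedSpace ℝ F] (v : F),
      BddCurve I (interior K) (fun _ _ => v) := fun v => hc contDiff_const
  have hgi := contDiff_ginv hγ hpos
  have hF0 : BddCurve I (interior K) F := ⟨_, hF.base⟩
  have hF1 : BddCurve I (interior K) (fun t y => fderiv ℝ (F t) y) := ⟨_, hF.2.2.base⟩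
  have hu1 : BddCurve I (interior K) (fun _ y => fderiv ℝ u y) := .of_bddDiff hI hU hu.2.2
  have hu2 : BddCurve I (interior K) (fun _ y => fderiv ℝ (fderiv ℝ u) y) :=
    .of_bddDiff hI hU hu.2.2.2.2
  have hlu : BddCurve I (interior K) (fun _ y => lapB γ u y) :=
    (hu.diffFamily hI hU).bddCurve_lapB hγ hpos hI hK hKu
  have hneg : ∀ {F : Type} [NormedAddCommGroup F] [NormedSpace ℝ F] {p q : ℝ → Em m → F},
      BddCurve I (interior K) p → BddCurve I (interior K) q →
      BddCurve I (interior K) (fun t y => p t y - q t y) := fun {F} _ _ p q hp hq =>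
    (hp.add hI hU ((hc' (-1 : ℝ)).smul hq)).congr hI fun t _ y _ => by
      rw [neg_one_smul, sub_eq_add_neg]
  have hvec : BddCurve I (interior K) (fun t y => innerVec γ u (T t) (F t) y) := by
    refine BddCurve.add hI hU (BddCurve.add hI hU (BddCurve.sum hI hU fun i =>
      BddCurve.sum hI hU fun j => hneg ((hc (hgi i j)).smul (BddCurve.add hI hU
        ((hu2.clm_apply (hF1.clm_apply (hc' _))).clm_apply (hc' _))
        ((hu2.clm_apply (hc' _)).clm_apply (hF1.clm_apply (hc' _)))))
        (((hc ((hgi i j).fderiv_right (by simp))).clm_apply hF0).smul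
          ((hu2.clm_apply (hc' _)).clm_apply (hc' _))))
      (hu1.clm_apply (BddCurve.add hI hU (hF.bddCurve_lapB hγ hpos hI hK hKu)
        ((hc ((contDiff_chrVec hγ hpos).fderiv_right (by simp))).clm_apply hF0))))
      (hT.bddCurve_lapB hγ hpos hI hK hKu)
  have hdiv : ∀ k, BddCurve I (interior K) (fun t y => pd k (fun x => sqg γ x * F t x k) y) :=
    fun k => by
    have h1 := ((BddDiff.of_contDiff hK hKu 2 (contDiff_sqg hγ hpos)).diffFamily hI hU).bilin hI hU
      (ContinuousLinearMap.mul ℝ ℝ) (hF.clm hI hU (EuclideanSpace.proj k))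
    have h2 : BddCurve I (interior K) (fun t y => fderiv ℝ (fun x => sqg γ x * F t x k) y) :=
      ⟨_, h1.2.2.base⟩
    exact h2.clm_apply (hc' _)
  refine (hneg ((hc' (2 : ℝ)).smul ((hc (contDiff_sqg hγ hpos)).smul (hlu.inner hvec)))
    ((hlu.inner hlu).smul (BddCurve.sum hI hU hdiv))).congr hI fun t _ y _ => ?_
  simp only [_root_.innerDens, smul_eq_mul, real_inner_self_eq_norm_sq]

end InnerVariation

section InnerVariation

open scoped ContDiff

variable {m n : ℕ} {R : ℝ} {γ : Em m → Matrix (Fin m) (Fin m) ℝ} {g u : Em m → Em n}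

theorem innerDens_congr {U : Set (Em m)} (hU : IsOpen U) {T S : Em m → Em n}
    {X Y : Em m → Em m} (hT : ∀ y ∈ U, T y = S y) (hX : ∀ y ∈ U, X y = Y y) {y : Em m}
    (hy : y ∈ U) : innerDens γ u T X y = innerDens γ u S Y y := by
  have h : ∀ k, pd k (fun x => sqg γ x * X x k) y = pd k (fun x => sqg γ x * Y x k) y := fun k => by
    rw [pd, pd, fderiv_eq_of_eqOn hU (fun z hz => by rw [hX z hz]) hy]
  simp only [innerDens, innerVec, h, fderiv_eq_of_eqOn hU hX hy, hX y hy, lapB_congr hU hX hy,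
    lapB_congr hU hT hy]

/-- The first variation formula for smooth tangential vector fields on the closed half-ball. -/
theorem setIntegral_innerDens_eq_zero_of_contDiffOn (hm : 0 < m) (hR : 0 < R)
    (hγ : ∀ i j, ContDiff ℝ ∞ (fun y => γ y i j)) (hpos : ∀ x, (γ x).PosDef)
    (hg : ContDiffOn ℝ 3 g (closedHalfBall m R)) (hu : ContDiffOn ℝ 2 u (closedHalfBall m R))
    (huS : ∀ x ∈ closedHalfBall m R, ‖u x‖ = 1) (hvb : VarBiharmonic m n R γ g u)
    {X : Em m → Em m} (hX : ContDiffOn ℝ ∞ X (closedHalfBall m R))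
    (h₁ : ∀ x, ‖x‖ ≤ R → lastCLM m x = 0 → lastCLM m (X x) = 0)
    (h₂ : ∀ x, ‖x‖ = R → 0 ≤ lastCLM m x → ⟪X x, x⟫ = 0) :
    IntegrableOn (innerDens γ u (tanVar g u X) X) (openHalfBall m R) ∧
      ∫ y in openHalfBall m R, innerDens γ u (tanVar g u X) X y = 0 := by
  have hK := isCompact_closedHalfBall (m := m) R
  have hKu := uniqueDiffOn_closedHalfBall (m := m) hm hR
  have hU := isOpen_openHalfBall (m := m) R
  have hint := interior_closedHalfBall (m := m) hm hR
  obtain ⟨F, hF, hF0, hFs⟩ := exists_tangential_approx hm hR hX h₁ h₂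
  have hI : IsOpen (Set.Ioo (-(1 / 2)) (1 / 2) : Set ℝ) := isOpen_Ioo
  have h0 : (0 : ℝ) ∈ Set.Ioo (-(1 / 2)) (1 / 2 : ℝ) := by norm_num
  have hFd := diffFamily_of_contDiffOn hK hKu (by norm_num) (k := 2)
    (hF.of_le (by norm_cast))
  have hu2 := ContDiffOn.bddDiff hK hKu (k := 2) hu
  obtain ⟨T', hT⟩ := hFd.exists_diffFamily_tanVar hI (hint ▸ hU)
    (ContDiffOn.bddDiff hK hKu (k := 3) hg) hu2
  obtain ⟨H, hH⟩ := BddCurve.innerDens hγ hpos hI hK hKu hu2 hT hFd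
  rw [hint] at hH
  have htan : ∀ {Y Z : Em m → Em m}, (∀ y ∈ openHalfBall m R, Y y = Z y) →
      ∀ y ∈ openHalfBall m R, innerDens γ u (tanVar g u Y) Y y =
        innerDens γ u (tanVar g u Z) Z y := fun h y hy =>
    innerDens_congr hU (fun z hz => by rw [tanVar, tanVar, h z hz]) h hy
  have hX0 := htan fun y hy => hF0 y (openHalfBall_subset hy)
  have hzero : ∀ s ∈ Set.Ioo (-(1 / 2)) (1 / 2 : ℝ), s ≠ 0 →
      ∫ y in openHalfBall m R, innerDens γ u (tanVar g u (F s)) (F s) y = 0 := fun s hs hs0 => by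
    obtain ⟨Y, hY, hYc, hY1, hY2, hYF⟩ := hFs s (Set.Ioo_subset_Icc_self hs) hs0
    rw [← setIntegral_innerDens_eq_zero hm hR hγ hpos hg hu huS hvb hY hYc hY1 hY2]
    exact setIntegral_congr_fun hU.measurableSet
      (htan fun y hy => (hYF y (openHalfBall_subset hy)).symm)
  constructor
  · obtain ⟨C, hC⟩ := hH.bdd
    refine IntegrableOn.congr_fun ?_ hX0 hU.measurableSet
    exact IntegrableOn.of_bound volume_openHalfBall_lt_top
      ((hH.cont 0 h0).aestronglyMeasurable hU.measurableSet) C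
      (ae_restrict_of_forall_mem hU.measurableSet (hC 0 h0))
  · rw [← setIntegral_congr_fun hU.measurableSet hX0]
    have hc := (hH.hasDerivAt_integral hU volume_openHalfBall_lt_top hI h0).2.continuousAt
    refine tendsto_nhds_unique_of_eventuallyEq (l := nhdsWithin (0 : ℝ) {0}ᶜ)
      (hc.tendsto.mono_left nhdsWithin_le_nhds) tendsto_const_nhds ?_
    filter_upwards [nhdsWithin_le_nhds (hI.mem_nhds h0), self_mem_nhdsWithin] with s hs hs0
    exact hzero s hs hs0

end InnerVariation

section InnerVariation

open scoped ContDiff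

variable {m n : ℕ} {R : ℝ} {γ : Em m → Matrix (Fin m) (Fin m) ℝ} {g u : Em m → Em n}
  {X : Em m → Em m}

theorem pd_apply {y : Em m} (hX : DifferentiableAt ℝ X y) (j k : Fin m) :
    pd j (fun z => X z k) y = fderiv ℝ X y (stdVec j) k := by
  have h := ((EuclideanSpace.proj (𝕜 := ℝ) k).hasFDerivAt.comp y hX.hasFDerivAt).fderiv
  exact congrArg (fun L => L (stdVec j)) h

theorem map_eq_sum_pd {F : Type} [NormedAddCommGroup F] [NormedSpace ℝ F] {f : Em m → F}
    (y v : Em m) : fderiv ℝ f y v = ∑ l, v l • pd l f y := by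
  conv_lhs => rw [← sum_smul_stdVec v]
  simp only [map_sum, map_smul]
  rfl

theorem tanVar_eq (y : Em m) : tanVar g u X y =
    (-1 : ℝ) • ((∑ l, X y l • pd l g y) - ⟪∑ l, X y l • pd l g y, u y⟫ • u y) := by
  rw [tanVar, map_eq_sum_pd, neg_one_smul]

theorem pd_const_smul (i : Fin m) (c : ℝ) (f : Em m → Em n) :
    pd i (c • f) = c • pd i f := by
  ext1 x
  simp [pd, fderiv_const_smul_field]

theorem lapB_const_smul (c : ℝ) (f : Em m → Em n) (y : Em m) :
    lapB γ (c • f) y = c • lapB γ f y := by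
  simp only [lapB, pd_const_smul, Finset.smul_sum, Pi.smul_apply, smul_sub]
  refine Finset.sum_congr rfl fun i _ => Finset.sum_congr rfl fun j _ => ?_
  congr 1
  · rw [smul_comm]
  · refine Finset.sum_congr rfl fun k _ => ?_
    rw [smul_comm c, smul_comm c]

theorem fderiv_chrVec (hγ : ∀ i j, ContDiff ℝ ∞ (fun y => γ y i j))
    (hpos : ∀ x, (γ x).PosDef) (y v : Em m) :
    fderiv ℝ (chrVec γ) y v = ∑ k, (∑ l, pd l (chrSum γ k) y * v l) • stdVec k := by
  have h : ∀ k, HasFDerivAt (chrSum γ k) (fderiv ℝ (chrSum γ k) y) y := fun k =>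
    ((contDiff_chrSum hγ hpos k).differentiable (by simp) y).hasFDerivAt
  have h1 := HasFDerivAt.fun_sum (u := Finset.univ) fun k _ =>
    (h k).smul_const (stdVec (m := m) k)
  rw [show chrVec γ = fun y => ∑ k, chrSum γ k y • stdVec k from rfl, h1.fderiv]
  simp [map_eq_sum_pd, mul_comm]

theorem inner_innerVec (hγ : ∀ i j, ContDiff ℝ ∞ (fun y => γ y i j))
    (hsymm : ∀ x, (γ x).IsSymm) (hpos : ∀ x, (γ x).PosDef) {U : Set (Em m)} (hU : IsOpen U)
    (hu : BddDiff U 2 u) {y : Em m} (hy : y ∈ U) (hX : DifferentiableAt ℝ X y) (T : Em m → Em n)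
    (v : Em n) :
    ⟪v, innerVec γ u T X y⟫ =
      2 * (∑ i, ∑ j, ∑ k, ginv γ y i j * ⟪v, pd i (pd k u) y⟫ * pd j (fun z => X z k) y)
      - (∑ i, ∑ j, ∑ l, pd l (fun z => ginv γ z i j) y * X y l * ⟪v, pd i (pd j u) y⟫)
      + (∑ k, lapB γ X y k * ⟪v, pd k u y⟫)
      + (∑ k, ∑ l, pd l (fun z => ∑ i, ∑ j, ginv γ z i j * christoffel γ k i j z) y * X y l
          * ⟪v, pd k u y⟫)
      + ⟪v, lapB γ T y⟫ := by
  have hD2 : ∀ i j, pd i (pd j u) y = fderiv ℝ (fderiv ℝ u) y (stdVec i) (stdVec j) :=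
    pd_pd_eq (hu.2.2.2.1 y hy)
  have hS : ∀ i j, ⟪v, fderiv ℝ (fderiv ℝ u) y (stdVec i) (fderiv ℝ X y (stdVec j))⟫ =
      ∑ k, ⟪v, pd i (pd k u) y⟫ * pd j (fun z => X z k) y := fun i j => by
    conv_lhs => rw [← sum_smul_stdVec (fderiv ℝ X y (stdVec j))]
    simp only [map_sum, map_smul, inner_sum, inner_smul_right, hD2, pd_apply hX, mul_comm]
  have hsec : (∑ i, ∑ j, ginv γ y i j *
        ⟪v, fderiv ℝ (fderiv ℝ u) y (fderiv ℝ X y (stdVec i)) (stdVec j)⟫) =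
      ∑ i, ∑ j, ginv γ y i j *
        ⟪v, fderiv ℝ (fderiv ℝ u) y (stdVec i) (fderiv ℝ X y (stdVec j))⟫ := by
    rw [Finset.sum_comm]
    refine Finset.sum_congr rfl fun i _ => Finset.sum_congr rfl fun j _ => ?_
    rw [ginv_symm hsymm y j i, hu.isSymm hU hy]
  have hchr : ∀ k, (fun z => ∑ i, ∑ j, ginv γ z i j * christoffel γ k i j z) = chrSum γ k :=
    fun _ => rfl
  have hl : ∀ w : Em m, ⟪v, fderiv ℝ u y w⟫ = ∑ k, w k * ⟪v, pd k u y⟫ := fun w => by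
    rw [map_eq_sum_pd, inner_sum]
    simp only [inner_smul_right]
  have hc : ∀ k, fderiv ℝ (chrVec γ) y (X y) k = ∑ l, pd l (chrSum γ k) y * X y l := fun k => by
    rw [fderiv_chrVec hγ hpos]
    simp [stdVec, Pi.single_apply]
  have hg : ∀ i j, fderiv ℝ (fun z => ginv γ z i j) y (X y) =
      ∑ l, pd l (fun z => ginv γ z i j) y * X y l := fun i j => by
    simp only [map_eq_sum_pd, smul_eq_mul, mul_comm]
  simp only [innerVec, inner_add_right, inner_sum, inner_sub_right, inner_smul_right, mul_add,
    Finset.sum_sub_distrib, Finset.sum_add_distrib, hsec, map_add, hl, hc, hchr, hg, ← hD2, hS,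
    Finset.sum_mul, Finset.mul_sum, mul_assoc, two_mul]
  ring

end InnerVariation

section InnerVariation

open scoped ContDiff

variable {m n : ℕ} {γ : Em m → Matrix (Fin m) (Fin m) ℝ} {g u : Em m → Em n}
  {X : Em m → Em m}

theorem innerDens_eq (hγ : ∀ i j, ContDiff ℝ ∞ (fun y => γ y i j))
    (hsymm : ∀ x, (γ x).IsSymm) (hpos : ∀ x, (γ x).PosDef) {U : Set (Em m)} (hU : IsOpen U)
    (hu : BddDiff U 2 u) {y : Em m} (hy : y ∈ U) (hX : DifferentiableAt ℝ X y) :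
    innerDens γ u (tanVar g u X) X y =
      sqg γ y * (4 * ∑ i, ∑ j, ∑ k, ginv γ y i j * ⟪lapB γ u y, pd i (pd k u) y⟫
            * pd j (fun z => X z k) y
          + 2 * ∑ k, lapB γ X y k * ⟪lapB γ u y, pd k u y⟫
          - ‖lapB γ u y‖ ^ 2 * ((∑ k, pd k (fun z => sqg γ z * X z k) y) / sqg γ y))
      - sqg γ y * (2 * ⟪lapB γ u y,
            lapB γ (fun z => (∑ l, X z l • pd l g z)
              - ⟪∑ l, X z l • pd l g z, u z⟫ • u z) y⟫
          + 2 * ∑ i, ∑ j, ∑ l, pd l (fun z => ginv γ z i j) y * X y l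
              * ⟪lapB γ u y, pd i (pd j u) y⟫
          - 2 * ∑ k, ∑ l,
              pd l (fun z => ∑ i, ∑ j, ginv γ z i j * christoffel γ k i j z) y * X y l
              * ⟪lapB γ u y, pd k u y⟫) := by
  have hs := (sqg_pos hpos y).ne'
  have hT : tanVar g u X = (-1 : ℝ) • fun z => (∑ l, X z l • pd l g z)
      - ⟪∑ l, X z l • pd l g z, u z⟫ • u z := funext tanVar_eq
  rw [innerDens, inner_innerVec hγ hsymm hpos hU hu hy hX, hT, lapB_const_smul, inner_smul_right]
  field_simp
  ring

theorem integral_eq_of_integrable_sub_of_integral_sub_eq_zero {α : Type*} [MeasurableSpace α]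
    {μ : Measure α} {f g : α → ℝ} (hi : Integrable (fun x => f x - g x) μ)
    (h0 : ∫ x, f x - g x ∂μ = 0) : ∫ x, f x ∂μ = ∫ x, g x ∂μ := by
  by_cases hf : Integrable f μ
  · have hg : Integrable g μ := (hf.sub hi).congr (.of_forall fun x => sub_sub_cancel (f x) (g x))
    rwa [integral_sub hf hg, sub_eq_zero] at h0
  · have hg : ¬ Integrable g μ := fun hg => hf ((hi.add hg).congr (.of_forall fun x => sub_add_cancel (f x) (g x)))
    rw [integral_undef hf, integral_undef hg]

end InnerVariation

/-- **Differential equation for variationally biharmonic maps** (Lemma 1, sphere-valued).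
For every smooth vector field `ξ` tangential to the boundary of the half-ball, the stated
integral identity holds. -/
theorem stmt_1 (m n : ℕ) (hm : 2 ≤ m) (hn : 2 ≤ n) (R : ℝ) (hR : 0 < R)
    (γ : Em m → Matrix (Fin m) (Fin m) ℝ)
    (hγ : ∀ i j : Fin m, ContDiff ℝ (⊤ : ℕ∞) (fun y => γ y i j))
    (hsymm : ∀ x, (γ x).IsSymm) (hpos : ∀ x, (γ x).PosDef)
    (g u : Em m → Em n)
    (hg : ContDiffOn ℝ 3 g (closure (halfBall m R)))
    (hgS : ∀ x ∈ closure (halfBall m R), ‖g x‖ = 1)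
    (hu : ContDiffOn ℝ 2 u (closure (halfBall m R)))
    (huS : ∀ x ∈ closure (halfBall m R), ‖u x‖ = 1)
    (hbc : ∀ x ∈ tPart m R, u x = g x ∧ fderiv ℝ u x = fderiv ℝ g x)
    (hvb : VarBiharmonic m n R γ g u) :
    ∀ ξ : Em m → Em m, ContDiffOn ℝ (⊤ : ℕ∞) ξ (closure (halfBall m R)) →
      (∀ x ∈ tPart m R, lastCoord (ξ x) = 0) →
      (∀ x : Em m, ‖x‖ = R → 0 ≤ lastCoord x → ⟪ξ x, x⟫ = 0) →
      ∫ x in halfBall m R,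
          (4 * ∑ i, ∑ j, ∑ k, ginv γ x i j * ⟪lapB γ u x, pd i (pd k u) x⟫
              * pd j (fun y => ξ y k) x
            + 2 * ∑ k, lapB γ ξ x k * ⟪lapB γ u x, pd k u x⟫
            - ‖lapB γ u x‖ ^ 2 * ((∑ k, pd k (fun y => sqg γ y * ξ y k) x) / sqg γ x))
          ∂muG γ
      = ∫ x in halfBall m R,
          (2 * ⟪lapB γ u x,
              lapB γ (fun y => (∑ l, ξ y l • pd l g y)
                - ⟪∑ l, ξ y l • pd l g y, u y⟫ • u y) x⟫
            + 2 * ∑ i, ∑ j, ∑ l, pd l (fun y => ginv γ y i j) x * ξ x l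
                * ⟪lapB γ u x, pd i (pd j u) x⟫
            - 2 * ∑ k, ∑ l,
                pd l (fun y => ∑ i, ∑ j, ginv γ y i j * christoffel γ k i j y) x * ξ x l
                * ⟪lapB γ u x, pd k u x⟫) ∂muG γ := by
  intro ξ hξ h₁ h₂
  have hm0 : 0 < m := by omega
  have hcl := closure_halfBall (m := m) hm0 hR
  rw [hcl] at hg hu huS hξ
  have hU := isOpen_openHalfBall (m := m) R
  obtain ⟨hi, h0⟩ := setIntegral_innerDens_eq_zero_of_contDiffOn hm0 hR hγ hpos hg hu huS hvb hξ
    (fun x hx hx' => by rw [← lastCoord_eq] at hx' ⊢; exact h₁ x ⟨hx, hx'⟩)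
    (fun x hx hx' => by rw [← lastCoord_eq] at hx'; exact h₂ x hx hx')
  have hK := isCompact_closedHalfBall (m := m) R
  have hKu := uniqueDiffOn_closedHalfBall (m := m) hm0 hR
  have hu2 : BddDiff (openHalfBall m R) 2 u :=
    interior_closedHalfBall (m := m) hm0 hR ▸ ContDiffOn.bddDiff hK hKu (k := 2) hu
  rw [setIntegral_muG hm0 hγ hpos, setIntegral_muG hm0 hγ hpos]
  refine integral_eq_of_integrable_sub_of_integral_sub_eq_zero
    (hi.congr_fun (fun y hy => ?_) hU.measurableSet)
    ((setIntegral_congr_fun hU.measurableSet fun y hy => ?_).symm.trans h0)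
  all_goals exact innerDens_eq hγ hsymm hpos hU hu2 hy ((hξ.differentiableOn (by simp) y
    (openHalfBall_subset hy)).differentiableAt (Filter.mem_of_superset (hU.mem_nhds hy)
      openHalfBall_subset))

end
end

section
/- Derivative of the Jacobian determinant of the inverse family: Let m ≥ 1 and let φ, ψ : ℝ × ℝ^m → ℝ^m be twice continuously differentiable maps with φ(0,x) = x and φ(t, ψ(t,x)) = x for all (t,x). Set ξ(x) := ∂_t φ(t,x)|_{t=0}. Then for every x ∈ ℝ^m, the function t ↦ det(D_x ψ(t,x)) is differentiable at t = 0 with derivative −div ξ(x) = −Σ_{k=1}^m ∂_k ξ^k(x). -/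
open MeasureTheory

noncomputable section

/-- A permutation fixing every point except possibly one is the identity. -/
theorem Equiv.Perm.exists_ne_apply_ne {n : Type*} {σ : Equiv.Perm n} (hσ : σ ≠ 1) (i : n) :
    ∃ j, j ≠ i ∧ σ j ≠ j := by
  by_contra! h
  refine hσ (Equiv.ext fun j => ?_)
  by_cases hj : j = i
  · subst hj
    by_contra hne
    exact hne (σ.injective (h (σ j) hne))
  · exact h j hj

/-- Jacobi's formula at the identity matrix. -/
theorem HasDerivAt.matrix_det_of_eq_one {n : Type*} [Fintype n] [DecidableEq n] {𝕜 : Type*}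
    [NontriviallyNormedField 𝕜] {M : 𝕜 → Matrix n n 𝕜} {M' : Matrix n n 𝕜} {t : 𝕜}
    (hM : ∀ i j, HasDerivAt (fun s => M s i j) (M' i j) t) (h1 : M t = 1) :
    HasDerivAt (fun s => (M s).det) M'.trace t := by
  have h : HasDerivAt
      (fun s => ∑ σ : Equiv.Perm n, ((Equiv.Perm.sign σ : ℤ) : 𝕜) * ∏ i, M s (σ i) i)
      (∑ σ : Equiv.Perm n, ((Equiv.Perm.sign σ : ℤ) : 𝕜) *
        ∑ i, (∏ j ∈ Finset.univ.erase i, M t (σ j) j) • M' (σ i) i) t :=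
    HasDerivAt.fun_sum fun σ _ =>
      (HasDerivAt.fun_finsetProd fun i _ => hM (σ i) i).const_mul _
  simp only [Matrix.det_apply']
  convert h using 1
  rw [Finset.sum_eq_single 1]
  · simp [h1, Matrix.trace]
  · intro σ _ hσ
    refine mul_eq_zero_of_right _ (Finset.sum_eq_zero fun i _ => ?_)
    obtain ⟨j, hji, hj⟩ := Equiv.Perm.exists_ne_apply_ne hσ i
    rw [Finset.prod_eq_zero (Finset.mem_erase.2 ⟨hji, Finset.mem_univ j⟩)
      (by rw [h1, Matrix.one_apply_ne hj]), zero_smul]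
  · simp

section PartialDerivatives

variable {E F : Type*} [NormedAddCommGroup E] [NormedSpace ℝ E] [NormedAddCommGroup F]
  [NormedSpace ℝ F] {f : ℝ → E → F}

theorem hasDerivAt_uncurry_left {t : ℝ} {x : E}
    (hf : DifferentiableAt ℝ (fun p : ℝ × E => f p.1 p.2) (t, x)) :
    HasDerivAt (fun s => f s x) (fderiv ℝ (fun p : ℝ × E => f p.1 p.2) (t, x) (1, 0)) t :=
  HasFDerivAt.comp_hasDerivAt (f := fun s : ℝ => (s, x)) t hf.hasFDerivAt
    ((hasDerivAt_id t).prodMk (hasDerivAt_const t x))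

theorem hasFDerivAt_uncurry_right {t : ℝ} {x : E}
    (hf : DifferentiableAt ℝ (fun p : ℝ × E => f p.1 p.2) (t, x)) :
    HasFDerivAt (f t)
      (fderiv ℝ (fun p : ℝ × E => f p.1 p.2) (t, x) ∘L ContinuousLinearMap.inr ℝ ℝ E) x :=
  HasFDerivAt.comp (f := fun y : E => (t, y)) x hf.hasFDerivAt (hasFDerivAt_prodMk_right t x)

/-- The mixed partial derivatives of a `C²` function commute. -/
theorem hasDerivAt_fderiv_apply_of_contDiff
    (hf : ContDiff ℝ 2 (fun p : ℝ × E => f p.1 p.2)) (t : ℝ) (x v : E) :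
    HasDerivAt (fun s => fderiv ℝ (f s) x v)
      (fderiv ℝ (fun y => deriv (fun s => f s y) t) x v) t := by
  set g : ℝ × E → F := fun p => f p.1 p.2 with hg
  have hd : Differentiable ℝ g := hf.differentiable two_ne_zero
  have hd' : Differentiable ℝ (fderiv ℝ g) :=
    (hf.fderiv_right (m := 1) le_rfl).differentiable one_ne_zero
  have hx : ∀ s, fderiv ℝ (f s) x v = fderiv ℝ g (s, x) (0, v) := fun s => by
    rw [(hasFDerivAt_uncurry_right (hd (s, x))).fderiv]
    simp [hg]
  have ht : ∀ y, deriv (fun s => f s y) t = fderiv ℝ g (t, y) (1, 0) := fun y =>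
    (hasDerivAt_uncurry_left (hd (t, y))).deriv
  have hmix : HasDerivAt (fun s => fderiv ℝ g (s, x) (0, v))
      (fderiv ℝ (fderiv ℝ g) (t, x) (1, 0) (0, v)) t := by
    have h := hasDerivAt_uncurry_left (f := fun s y => fderiv ℝ g (s, y)) (hd' (t, x))
    simpa using h.clm_apply (hasDerivAt_const t ((0, v) : ℝ × E))
  have hmix' : fderiv ℝ (fun y => fderiv ℝ g (t, y) (1, 0)) x v =
      fderiv ℝ (fderiv ℝ g) (t, x) (0, v) (1, 0) := by
    have h := hasFDerivAt_uncurry_right (f := fun s y => fderiv ℝ g (s, y)) (hd' (t, x))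
    rw [(h.clm_apply (hasFDerivAt_const ((1, 0) : ℝ × E) x)).fderiv]
    simp
  have hsymm : IsSymmSndFDerivAt ℝ g (t, x) := hf.contDiffAt.isSymmSndFDerivAt (by simp)
  simp only [hx, ht]
  rw [hmix', ← hsymm.eq]
  exact hmix

/-- The generator of a family of right inverses is the negative of the generator. -/
theorem deriv_rightInverse_family {φ ψ : ℝ → E → E}
    (hφ : Differentiable ℝ (fun p : ℝ × E => φ p.1 p.2))
    (hψ : Differentiable ℝ (fun p : ℝ × E => ψ p.1 p.2))
    (hφ0 : ∀ x, φ 0 x = x) (hinv : ∀ t x, φ t (ψ t x) = x) (x : E) :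
    deriv (fun t => ψ t x) 0 = -deriv (fun t => φ t x) 0 := by
  have hψ0 : ψ 0 x = x := by rw [← hφ0 (ψ 0 x), hinv]
  have hψx := hasDerivAt_uncurry_left (hψ (0, x))
  have hφx := hasDerivAt_uncurry_left (hφ (0, x))
  rw [hψx.deriv.symm] at hψx
  have hspace := (hasFDerivAt_uncurry_right (hφ (0, x))).unique
    ((hasFDerivAt_id x).congr_of_eventuallyEq (Filter.Eventually.of_forall hφ0))
  have hcomp : HasDerivAt (fun t => φ t (ψ t x))
      (fderiv ℝ (fun p : ℝ × E => φ p.1 p.2) (0, x) (1, deriv (fun t => ψ t x) 0)) 0 := by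
    refine HasFDerivAt.comp_hasDerivAt (f := fun t => (t, ψ t x))
      (l := fun p : ℝ × E => φ p.1 p.2) 0 ?_ ((hasDerivAt_id 0).prodMk hψx)
    simpa only [hψ0] using (hφ (0, x)).hasFDerivAt
  simp only [hinv] at hcomp
  have hzero := hcomp.unique (hasDerivAt_const 0 x)
  have hsplit : ((1, deriv (fun t => ψ t x) 0) : ℝ × E) =
      (1, 0) + ContinuousLinearMap.inr ℝ ℝ E (deriv (fun t => ψ t x) 0) := by simp
  rw [hsplit, map_add, ← ContinuousLinearMap.comp_apply, hspace, ← hφx.deriv] at hzero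
  exact eq_neg_of_add_eq_zero_right hzero

end PartialDerivatives

/-- **Derivative of the Jacobian determinant of the inverse family.**
If `φ, ψ : ℝ × ℝ^m → ℝ^m` are C², `φ 0 = id`, `φ t (ψ t x) = x`, and
`ξ x := ∂ₜφ(t,x)|₀`, then `t ↦ det D_xψ(t,x)` is differentiable at `0` with
derivative `−div ξ x = −∑ₖ ∂ₖξᵏ(x)`. -/
theorem stmt_4 (m : ℕ) (hm : 1 ≤ m)
    (φ ψ : ℝ → EuclideanSpace ℝ (Fin m) → EuclideanSpace ℝ (Fin m))
    (hφ : ContDiff ℝ 2 (fun p : ℝ × EuclideanSpace ℝ (Fin m) => φ p.1 p.2))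
    (hψ : ContDiff ℝ 2 (fun p : ℝ × EuclideanSpace ℝ (Fin m) => ψ p.1 p.2))
    (hφ0 : ∀ x, φ 0 x = x)
    (hinv : ∀ t x, φ t (ψ t x) = x)
    (ξ : EuclideanSpace ℝ (Fin m) → EuclideanSpace ℝ (Fin m))
    (hξ : ∀ x, ξ x = deriv (fun t => φ t x) 0) :
    ∀ x, HasDerivAt
      (fun t => LinearMap.det ((fderiv ℝ (fun y => ψ t y) x).toLinearMap))
      (-(∑ k, fderiv ℝ ξ x (EuclideanSpace.single k 1) k)) 0 := by
  intro x
  have hψ0 : ψ 0 = id := funext fun y => by rw [← hφ0 (ψ 0 y), hinv, id]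
  have hη : (fun y => deriv (fun t => ψ t y) 0) = -ξ := funext fun y => by
    rw [deriv_rightInverse_family (hφ.differentiable two_ne_zero)
      (hψ.differentiable two_ne_zero) hφ0 hinv, Pi.neg_apply, hξ]
  set b := (EuclideanSpace.basisFun (Fin m) ℝ).toBasis with hb
  have hentry : ∀ i j, HasDerivAt
      (fun t => LinearMap.toMatrix b b (fderiv ℝ (ψ t) x).toLinearMap i j)
      (LinearMap.toMatrix b b (-fderiv ℝ ξ x).toLinearMap i j) 0 := fun i j => by
    have h := hasDerivAt_fderiv_apply_of_contDiff hψ 0 x (EuclideanSpace.single j 1)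
    rw [hη, fderiv_neg] at h
    simpa [hb, LinearMap.toMatrix_apply, Function.comp_def] using
      (EuclideanSpace.proj (𝕜 := ℝ) i).hasFDerivAt.comp_hasDerivAt 0 h
  have hone : LinearMap.toMatrix b b (fderiv ℝ (ψ 0) x).toLinearMap = 1 := by
    rw [hψ0, fderiv_id]
    exact LinearMap.toMatrix_id b
  have hdet := HasDerivAt.matrix_det_of_eq_one hentry hone
  simp only [LinearMap.det_toMatrix] at hdet
  have htrace : (LinearMap.toMatrix b b (-fderiv ℝ ξ x).toLinearMap).trace =
      -(∑ k, fderiv ℝ ξ x (EuclideanSpace.single k 1) k) := by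
    simp [hb, Matrix.trace, LinearMap.toMatrix_apply]
  exact htrace ▸ hdet

end
end
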